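/- arXiv:1607.01731 — 12 statements merged into one kernel-verified Lean document; each statement's English description precedes it below -/
import Mathlib

section
/- A nontrivial Puiseux monoid is isomorphic as an additive monoid to a numerical semigroup if and only if it is finitely generated. -/
/-- A Puiseux monoid is an additive submonoid of the nonnegative rationals. -/
def IsPuiseux (M : AddSubmonoid ℚ) : Prop := ∀ x ∈ M, 0 ≤ x

/-- An additive submonoid contained in the range of an injective homomorphism is isomorphic to
its preimage. -/
theorem AddSubmonoid.nonempty_addEquiv_comap {A B : Type*} [AddMonoid A] [AddMonoid B]
    (f : A →+ B) (hf : Function.Injective f) {S : AddSubmonoid B}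
    (hS : S ≤ AddMonoidHom.mrange f) : Nonempty (S ≃+ S.comap f) :=
  ⟨(AddEquiv.addSubmonoidCongr (map_comap_eq_self hS).symm).trans
    ((S.comap f).equivMapOfInjective f hf).symm⟩

/-- Every nonzero additive submonoid of `ℕ` is isomorphic to a numerical semigroup: divide by
the greatest common divisor. -/
theorem exists_cofinite_addEquiv_of_ne_bot (P : AddSubmonoid ℕ) (hP : P ≠ ⊥) :
    ∃ N : AddSubmonoid ℕ, (Set.univ \ (N : Set ℕ)).Finite ∧ Nonempty (P ≃+ N) := by
  set g := Nat.setGcd (P : Set ℕ)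
  have hg0 : g ≠ 0 := fun h ↦ hP <|
    (AddSubmonoid.eq_bot_iff_forall P).2 fun _ hx ↦ Nat.setGcd_eq_zero_iff.1 h hx
  let f : ℕ →+ ℕ := AddMonoidHom.mulLeft g
  have hf : Function.Injective f := mul_right_injective₀ hg0
  have hrange : P ≤ AddMonoidHom.mrange f := fun x hx ↦ by
    obtain ⟨y, rfl⟩ := Nat.setGcd_dvd_of_mem hx
    exact ⟨y, rfl⟩
  refine ⟨P.comap f, ?_, AddSubmonoid.nonempty_addEquiv_comap f hf hrange⟩
  obtain ⟨n, hn⟩ := Nat.exists_mem_closure_of_ge (P : Set ℕ)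
  refine (Set.finite_lt_nat n).subset fun m hm ↦ ?_
  by_contra hnm
  refine hm.2 ?_
  have hle : n ≤ g * m := (not_lt.1 hnm).trans (Nat.le_mul_of_pos_left m (Nat.pos_of_ne_zero hg0))
  simpa [f] using hn (g * m) hle (Dvd.intro m rfl)

/-- A finitely generated additive monoid of nonnegative rationals has a common denominator. -/
theorem IsPuiseux.exists_common_denominator {M : AddSubmonoid ℚ} (hM : IsPuiseux M)
    (hfg : M.FG) : ∃ d : ℕ, d ≠ 0 ∧ ∀ x ∈ M, ∃ n : ℕ, (n : ℚ) = d * x := by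
  obtain ⟨s, rfl⟩ := hfg
  refine ⟨∏ x ∈ s, x.den, Finset.prod_ne_zero_iff.2 fun x _ ↦ x.den_nz, fun x hx ↦ ?_⟩
  induction hx using AddSubmonoid.closure_induction with
  | mem x hx =>
    obtain ⟨c, hc⟩ := Finset.dvd_prod_of_mem Rat.den hx
    refine ⟨c * x.num.toNat, ?_⟩
    have hnum : (x.num.toNat : ℚ) = x.num := by
      exact_mod_cast Int.toNat_of_nonneg
        (Rat.num_nonneg.2 (hM x (AddSubmonoid.subset_closure hx)))
    rw [hc, Nat.cast_mul, Nat.cast_mul, hnum, ← Rat.mul_den_eq_num x]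
    ring
  | zero => exact ⟨0, by simp⟩
  | add x y _ _ hx hy =>
    obtain ⟨m, hm⟩ := hx
    obtain ⟨n, hn⟩ := hy
    exact ⟨m + n, by rw [Nat.cast_add, hm, hn, mul_add]⟩

/-- A finitely generated additive monoid of nonnegative rationals is isomorphic to an additive
submonoid of `ℕ`. -/
theorem IsPuiseux.exists_addEquiv_nat {M : AddSubmonoid ℚ} (hM : IsPuiseux M) (hfg : M.FG) :
    ∃ P : AddSubmonoid ℕ, Nonempty (M ≃+ P) := by
  obtain ⟨d, hd, h⟩ := hM.exists_common_denominator hfg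
  have hd' : (d : ℚ) ≠ 0 := Nat.cast_ne_zero.2 hd
  let f : ℕ →+ ℚ := (AddMonoidHom.mulLeft (d : ℚ)⁻¹).comp (Nat.castAddMonoidHom ℚ)
  have hf : Function.Injective f :=
    (mul_right_injective₀ (inv_ne_zero hd')).comp Nat.cast_injective
  refine ⟨M.comap f, AddSubmonoid.nonempty_addEquiv_comap f hf fun x hx ↦ ?_⟩
  obtain ⟨n, hn⟩ := h x hx
  exact ⟨n, by simp [f, hn, hd']⟩

/-- A nontrivial Puiseux monoid is isomorphic (as an additive monoid) to a
numerical semigroup if and only if it is finitely generated. -/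
theorem puiseux_iso_numerical_iff_fg (M : AddSubmonoid ℚ)
    (hM : IsPuiseux M) (hnt : M ≠ ⊥) :
    (∃ N : AddSubmonoid ℕ, (Set.univ \ (N : Set ℕ)).Finite ∧ Nonempty (M ≃+ N)) ↔
    (∃ S : Set ℚ, S.Finite ∧ AddSubmonoid.closure S = M) := by
  have hfg : (∃ S : Set ℚ, S.Finite ∧ AddSubmonoid.closure S = M) ↔ M.FG := by
    simp only [AddSubmonoid.fg_iff, and_comm]
  rw [hfg]
  constructor
  · rintro ⟨N, -, ⟨e⟩⟩
    have : AddMonoid.FG N := (AddMonoid.fg_iff_addSubmonoid_fg N).2 (Nat.addSubmonoid_fg N)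
    exact (AddMonoid.fg_iff_addSubmonoid_fg M).1
      (AddMonoid.fg_of_surjective e.symm.toAddMonoidHom e.symm.surjective)
  · intro h
    obtain ⟨P, ⟨e⟩⟩ := hM.exists_addEquiv_nat h
    have hP : P ≠ ⊥ := by
      rintro rfl
      refine hnt ((AddSubmonoid.eq_bot_iff_forall M).2 fun x hx ↦ ?_)
      have hex : e ⟨x, hx⟩ = 0 := Subtype.ext (e ⟨x, hx⟩).2
      exact congrArg Subtype.val (e.map_eq_zero_iff.1 hex)
    obtain ⟨N, hN, ⟨e'⟩⟩ := exists_cofinite_addEquiv_of_ne_bot P hP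
    exact ⟨N, hN, ⟨e.trans e'⟩⟩
end

section
/- For a Puiseux monoid M, the following conditions are equivalent: (1) M contains a minimal set of generators; (2) M contains a unique minimal set of generators; (3) M is atomic. Moreover, when these hold, the unique minimal set of generators of M is exactly its set of atoms 𝒜(M). -/
/-- `a` is an atom of the Puiseux monoid `M`. -/
def PMAtom (M : AddSubmonoid ℚ) (a : ℚ) : Prop :=
  a ∈ M ∧ a ≠ 0 ∧ ∀ x ∈ M, ∀ y ∈ M, a = x + y → x = 0 ∨ y = 0

/-- The set of atoms of `M`. -/
def PMAtoms (M : AddSubmonoid ℚ) : Set ℚ := {a | PMAtom M a}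

/-- `M` is atomic: every element of `M` is a finite sum of atoms of `M`. -/
def PMAtomic (M : AddSubmonoid ℚ) : Prop :=
  ∀ m ∈ M, ∃ l : Multiset ℚ, (∀ a ∈ l, PMAtom M a) ∧ l.sum = m

/-- `S` is a minimal generating set of `M`. -/
def MinimalGenSet (M : AddSubmonoid ℚ) (S : Set ℚ) : Prop :=
  AddSubmonoid.closure S = M ∧ ∀ T : Set ℚ, T ⊂ S → AddSubmonoid.closure T ≠ M

/-- Every generating set of `M` contains all atoms of `M`. -/
theorem PMAtoms_subset_of_closure_eq {M : AddSubmonoid ℚ} {S : Set ℚ}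
    (hS : AddSubmonoid.closure S = M) : PMAtoms M ⊆ S := by
  intro a ha
  have haS : a ∈ AddSubmonoid.closure S := hS ▸ ha.1
  induction haS using AddSubmonoid.closure_induction with
  | mem x hx => exact hx
  | zero => exact absurd rfl ha.2.1
  | add x y hx hy ihx ihy =>
    rcases ha.2.2 x (hS ▸ hx) y (hS ▸ hy) rfl with rfl | rfl
    · rw [zero_add] at ha ⊢
      exact ihy ha
    · rw [add_zero] at ha ⊢
      exact ihx ha

/-- An element smaller than a generator `s` can be written without using `s`. -/
theorem IsPuiseux.mem_closure_diff_of_lt {M : AddSubmonoid ℚ} (hM : IsPuiseux M) {S : Set ℚ}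
    (hS : AddSubmonoid.closure S = M) {s x : ℚ} (hx : x ∈ M) (hxs : x < s) :
    x ∈ AddSubmonoid.closure (S \ {s}) := by
  rw [← hS] at hx
  induction hx using AddSubmonoid.closure_induction with
  | mem x hx => exact AddSubmonoid.subset_closure ⟨hx, hxs.ne⟩
  | zero => exact zero_mem _
  | add x y hx hy ihx ihy =>
    have hx0 := hM x (hS ▸ hx)
    have hy0 := hM y (hS ▸ hy)
    exact add_mem (ihx (by linarith)) (ihy (by linarith))

/-- No element of a minimal generating set is generated by the others. -/
theorem MinimalGenSet.notMem_closure_diff {M : AddSubmonoid ℚ} {S : Set ℚ}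
    (hS : MinimalGenSet M S) {s : ℚ} (hs : s ∈ S) :
    s ∉ AddSubmonoid.closure (S \ {s}) := by
  intro h
  refine hS.2 (S \ {s}) (Set.sdiff_singleton_ssubset.2 hs) (le_antisymm ?_ ?_)
  · exact (AddSubmonoid.closure_mono Set.sdiff_subset).trans_eq hS.1
  · rw [← hS.1, AddSubmonoid.closure_le]
    intro t ht
    by_cases hts : t = s
    · exact hts ▸ h
    · exact AddSubmonoid.subset_closure ⟨ht, hts⟩

/-- A minimal generating set of a Puiseux monoid is its set of atoms. -/
theorem MinimalGenSet.eq_PMAtoms {M : AddSubmonoid ℚ} (hM : IsPuiseux M) {S : Set ℚ}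
    (hS : MinimalGenSet M S) : S = PMAtoms M := by
  refine Set.Subset.antisymm (fun s hs => ?_) (PMAtoms_subset_of_closure_eq hS.1)
  have hn := hS.notMem_closure_diff hs
  refine ⟨hS.1 ▸ AddSubmonoid.subset_closure hs, fun h0 => hn (h0 ▸ zero_mem _), ?_⟩
  intro x hx y hy hxy
  by_contra! hne
  have hx0 := (hM x hx).lt_of_ne' hne.1
  have hy0 := (hM y hy).lt_of_ne' hne.2
  have hsum := add_mem (hM.mem_closure_diff_of_lt hS.1 hx (s := s) (by linarith))
    (hM.mem_closure_diff_of_lt hS.1 hy (s := s) (by linarith))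
  exact hn (hxy ▸ hsum)

theorem PMAtomic_iff_closure_PMAtoms_eq {M : AddSubmonoid ℚ} :
    PMAtomic M ↔ AddSubmonoid.closure (PMAtoms M) = M := by
  have hle : AddSubmonoid.closure (PMAtoms M) ≤ M :=
    AddSubmonoid.closure_le.2 fun a ha => ha.1
  constructor
  · intro h
    refine le_antisymm hle fun m hm => ?_
    obtain ⟨l, hl, rfl⟩ := h m hm
    exact AddSubmonoid.multiset_sum_mem _ l fun a ha => AddSubmonoid.subset_closure (hl a ha)
  · intro h m hm
    rw [← h] at hm
    exact AddSubmonoid.exists_multiset_of_mem_closure hm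

/-- The atoms of an atomic monoid form a minimal generating set. -/
theorem PMAtomic.minimalGenSet_PMAtoms {M : AddSubmonoid ℚ} (h : PMAtomic M) :
    MinimalGenSet M (PMAtoms M) :=
  ⟨PMAtomic_iff_closure_PMAtoms_eq.1 h,
    fun _ hT hTM => hT.not_subset (PMAtoms_subset_of_closure_eq hTM)⟩

/-- For a Puiseux monoid `M`, the following are equivalent:
(1) `M` has a minimal set of generators; (2) `M` has a unique minimal set of generators;
(3) `M` is atomic. Moreover, when these hold, the unique minimal generating set is `𝒜(M)`. -/
theorem puiseux_minimal_generators_iff_atomic (M : AddSubmonoid ℚ) (hM : IsPuiseux M) :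
    ((∃ S : Set ℚ, MinimalGenSet M S) ↔ PMAtomic M) ∧
    ((∃! S : Set ℚ, MinimalGenSet M S) ↔ PMAtomic M) ∧
    (PMAtomic M → ∀ S : Set ℚ, MinimalGenSet M S → S = PMAtoms M) := by
  have atomic_of_minimal {S : Set ℚ} (hS : MinimalGenSet M S) : PMAtomic M :=
    PMAtomic_iff_closure_PMAtoms_eq.2 (hS.eq_PMAtoms hM ▸ hS.1)
  refine ⟨⟨fun ⟨_, hS⟩ => atomic_of_minimal hS, fun h => ⟨_, h.minimalGenSet_PMAtoms⟩⟩,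
    ⟨fun ⟨_, hS, _⟩ => atomic_of_minimal hS,
      fun h => ⟨_, h.minimalGenSet_PMAtoms, fun _ hS => hS.eq_PMAtoms hM⟩⟩,
    fun _ _ hS => hS.eq_PMAtoms hM⟩
end

section
/- For a Puiseux monoid M, the following conditions are equivalent: (1) there is a finite set of primes P such that v_p(m) ≥ 0 for every nonzero m ∈ M and every prime p ∉ P, and for every prime p the set {v_p(m) : m ∈ M, m ≠ 0} is bounded from below; (2) the denominator set d(M•) = {d(m) : m ∈ M, m ≠ 0} is bounded; (3) whenever M = ⟨R⟩ for a set R of nonnegative rationals, the denominator set d(R•) is bounded. Moreover, if any (and hence all) of these conditions holds, then M is atomic. -/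
theorem padicValRat_eq_neg_of_dvd_den {p : ℕ} (hp : p.Prime) {m : ℚ} (h : p ∣ m.den) :
    padicValRat p m = -(padicValNat p m.den : ℤ) := by
  have hnum : ¬ (p : ℤ) ∣ m.num := fun hn =>
    hp.not_dvd_one (m.reduced ▸ Nat.dvd_gcd (Int.natCast_dvd.mp hn) h)
  rw [padicValRat, padicValInt.eq_zero_of_not_dvd hnum]
  simp

theorem neg_den_le_padicValRat (p : ℕ) (m : ℚ) : -(m.den : ℤ) ≤ padicValRat p m := by
  have h : padicValNat p m.den ≤ m.den :=
    (padicValNat_le_nat_log _).trans (Nat.log_le_self _ _)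
  rw [padicValRat]
  omega

theorem den_dvd_prod_of_padicValRat_bounds {P : Finset ℕ} {B : ℕ → ℤ} {m : ℚ}
    (hP : ∀ p : ℕ, p.Prime → p ∉ P → 0 ≤ padicValRat p m)
    (hB : ∀ p : ℕ, p.Prime → B p ≤ padicValRat p m) :
    m.den ∣ ∏ p ∈ P, p ^ (-B p).toNat := by
  rw [Nat.dvd_iff_prime_pow_dvd_dvd]
  intro p k hp hk
  rcases Nat.eq_zero_or_pos k with rfl | hk0
  · simp
  have := Fact.mk hp
  have hv := padicValRat_eq_neg_of_dvd_den hp ((dvd_pow_self p hk0.ne').trans hk)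
  have hle : k ≤ padicValNat p m.den := (padicValNat_dvd_iff_le m.den_nz).mp hk
  have hpP : p ∈ P := by
    by_contra hpP
    have := hP p hp hpP
    omega
  have hBp := hB p hp
  exact (pow_dvd_pow p (by omega)).trans (Finset.dvd_prod_of_mem _ hpP)

theorem PMAtomic.of_den_dvd {M : AddSubmonoid ℚ} (hM : IsPuiseux M) {D : ℕ} (hD : 0 < D)
    (h : ∀ m ∈ M, m.den ∣ D) : PMAtomic M := by
  have hnat : ∀ m ∈ M, ∃ n : ℕ, m * D = n := by
    intro m hm
    obtain ⟨c, hc⟩ := h m hm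
    obtain ⟨a, ha⟩ := Int.eq_ofNat_of_zero_le (Rat.num_nonneg.mpr (hM m hm))
    refine ⟨a * c, ?_⟩
    rw [hc, Nat.cast_mul, ← mul_assoc, Rat.mul_den_eq_num, ha]
    push_cast
    rfl
  have hDQ : (0 : ℚ) < D := by exact_mod_cast hD
  suffices H : ∀ n : ℕ, ∀ m ∈ M, m * D = n →
      ∃ l : Multiset ℚ, (∀ a ∈ l, PMAtom M a) ∧ l.sum = m by
    intro m hm
    obtain ⟨n, hn⟩ := hnat m hm
    exact H n m hm hn
  intro n
  induction n using Nat.strong_induction_on with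
  | _ n ih =>
    intro m hm hn
    by_cases hm0 : m = 0
    · exact ⟨0, by simp, by simp [hm0]⟩
    by_cases hatom : PMAtom M m
    · exact ⟨{m}, by simpa using hatom, by simp⟩
    have hsplit : ∃ x ∈ M, ∃ y ∈ M, m = x + y ∧ x ≠ 0 ∧ y ≠ 0 := by
      by_contra! hcon
      exact hatom ⟨hm, hm0, fun x hx y hy hxy => or_iff_not_imp_left.mpr (hcon x hx y hy hxy)⟩
    obtain ⟨x, hx, y, hy, rfl, hx0, hy0⟩ := hsplit
    obtain ⟨a, ha⟩ := hnat x hx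
    obtain ⟨b, hb⟩ := hnat y hy
    have ha0 : a ≠ 0 := by
      rintro rfl
      simp [hx0, hDQ.ne'] at ha
    have hb0 : b ≠ 0 := by
      rintro rfl
      simp [hy0, hDQ.ne'] at hb
    have hab : a + b = n := by
      rw [add_mul, ha, hb] at hn
      exact_mod_cast hn
    obtain ⟨k, hk, hkx⟩ := ih a (by omega) x hx ha
    obtain ⟨l, hl, hly⟩ := ih b (by omega) y hy hb
    refine ⟨k + l, fun z hz => ?_, by rw [Multiset.sum_add, hkx, hly]⟩
    exact (Multiset.mem_add.mp hz).elim (hk z) (hl z)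

/-- For a Puiseux monoid `M`, the following are equivalent:
(1) there is a finite set `P` of primes such that `v_p(m) ≥ 0` for all nonzero `m ∈ M` and all
primes `p ∉ P`, and for every prime `p` the set `{v_p(m) : m ∈ M, m ≠ 0}` is bounded below;
(2) the denominator set of `M \ {0}` is bounded;
(3) whenever `M = ⟨R⟩` for a set `R` of nonnegative rationals, the denominator set of
`R \ {0}` is bounded. Moreover, any of these conditions implies that `M` is atomic. -/
theorem puiseux_bounded_denominators (M : AddSubmonoid ℚ) (hM : IsPuiseux M) :
    ((∃ P : Finset ℕ, (∀ p ∈ P, p.Prime) ∧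
        (∀ m ∈ M, m ≠ 0 → ∀ p : ℕ, p.Prime → p ∉ P → 0 ≤ padicValRat p m) ∧
        (∀ p : ℕ, p.Prime → ∃ B : ℤ, ∀ m ∈ M, m ≠ 0 → B ≤ padicValRat p m))
      ↔ (∃ B : ℕ, ∀ m ∈ M, m ≠ 0 → m.den ≤ B)) ∧
    ((∃ B : ℕ, ∀ m ∈ M, m ≠ 0 → m.den ≤ B)
      ↔ (∀ R : Set ℚ, (∀ r ∈ R, 0 ≤ r) → AddSubmonoid.closure R = M →
          ∃ B : ℕ, ∀ r ∈ R, r ≠ 0 → r.den ≤ B)) ∧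
    ((∃ B : ℕ, ∀ m ∈ M, m ≠ 0 → m.den ≤ B) → PMAtomic M) := by
  refine ⟨⟨?_, ?_⟩, ⟨?_, ?_⟩, ?_⟩
  · rintro ⟨P, hPp, hP, hB⟩
    have hB' : ∀ p : ℕ, ∃ B : ℤ, p.Prime → ∀ m ∈ M, m ≠ 0 → B ≤ padicValRat p m := by
      intro p
      by_cases hp : p.Prime
      · obtain ⟨B, h⟩ := hB p hp
        exact ⟨B, fun _ => h⟩
      · exact ⟨0, fun h => absurd h hp⟩
    choose B hB using hB'
    refine ⟨∏ p ∈ P, p ^ (-B p).toNat, fun m hm hm0 => Nat.le_of_dvd ?_ ?_⟩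
    · exact Finset.prod_pos fun p hp => pow_pos (hPp p hp).pos _
    · exact den_dvd_prod_of_padicValRat_bounds (hP m hm hm0) fun p hp => hB p hp m hm hm0
  · rintro ⟨B, hB⟩
    refine ⟨(Finset.range (B + 1)).filter Nat.Prime, by simp, ?_, ?_⟩
    · intro m hm hm0 p hp hpB
      have hnd : ¬ p ∣ m.den := by
        intro hd
        have h1 := (Nat.le_of_dvd m.pos hd).trans (hB m hm hm0)
        exact hpB (Finset.mem_filter.mpr ⟨Finset.mem_range.mpr (by omega), hp⟩)
      rw [padicValRat, padicValNat.eq_zero_of_not_dvd hnd]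
      omega
    · intro p _
      refine ⟨-B, fun m hm hm0 => ?_⟩
      have h1 := hB m hm hm0
      have h2 := neg_den_le_padicValRat p m
      omega
  · rintro ⟨B, hB⟩ R - rfl
    exact ⟨B, fun r hr => hB r (AddSubmonoid.subset_closure hr)⟩
  · intro h
    exact h M hM (AddSubmonoid.closure_eq M)
  · rintro ⟨B, hB⟩
    refine PMAtomic.of_den_dvd hM B.factorial_pos fun m hm => ?_
    by_cases hm0 : m = 0
    · simp [hm0]
    · exact Nat.dvd_factorial m.pos (hB m hm hm0)
end

section
/- Let M be a Puiseux monoid. If 0 is not a limit point of M (i.e., there exists ε > 0 such that no nonzero element of M is less than ε), then M is atomic. -/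
/-- If `0` is not a limit point of a Puiseux monoid `M` (there is `ε > 0` such
that no nonzero element of `M` is smaller than `ε`), then `M` is atomic. -/
theorem puiseux_atomic_of_zero_not_limit_point (M : AddSubmonoid ℚ) (hM : IsPuiseux M)
    (hlim : ∃ ε : ℚ, 0 < ε ∧ ∀ x ∈ M, x ≠ 0 → ε ≤ x) :
    PMAtomic M := by
  obtain ⟨ε, hε, hgap⟩ := hlim
  have bounded (n : ℕ) : ∀ m ∈ M, m < n * ε →
      ∃ l : Multiset ℚ, (∀ a ∈ l, PMAtom M a) ∧ l.sum = m := by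
    induction n with
    | zero =>
      intro m hm hlt
      have := hM m hm
      simp only [Nat.cast_zero, zero_mul] at hlt
      linarith
    | succ n ih =>
      intro m hm hlt
      push_cast at hlt
      by_cases h0 : m = 0
      · exact ⟨0, by simp, by simp [h0]⟩
      by_cases hatom : PMAtom M m
      · exact ⟨{m}, by simpa using hatom, by simp⟩
      have hsplit : ∃ x ∈ M, ∃ y ∈ M, m = x + y ∧ x ≠ 0 ∧ y ≠ 0 := by
        by_contra! h
        exact hatom ⟨hm, h0, fun x hx y hy hxy => or_iff_not_imp_left.2 (h x hx y hy hxy)⟩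
      obtain ⟨x, hx, y, hy, rfl, hx0, hy0⟩ := hsplit
      have hεx := hgap x hx hx0
      have hεy := hgap y hy hy0
      obtain ⟨l, hl, rfl⟩ := ih x hx (by linarith)
      obtain ⟨k, hk, rfl⟩ := ih y hy (by linarith)
      exact ⟨l + k, fun a ha => (Multiset.mem_add.1 ha).elim (hl a) (hk a),
        Multiset.sum_add l k⟩
  intro m hm
  obtain ⟨n, hn⟩ := exists_nat_gt (m / ε)
  exact bounded n m hm ((div_lt_iff₀ hε).1 hn)
end

section
/- Let p be a prime and let {a_n} be a sequence of positive integers such that a_1 > p, gcd(a_n, p) = 1 for every n, and a_{n+1}/p^{n+1} > a_n/p^n for every n. Then the Puiseux monoid M = ⟨a_n/p^n : n ∈ ℕ⟩ satisfies 𝒜(M) = {a_n/p^n : n ∈ ℕ}; in particular M is atomic, has infinitely many atoms, and is not strongly bounded. -/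
/-- `M` is strongly bounded: it is generated by a set whose numerator set is bounded. -/
def StronglyBounded (M : AddSubmonoid ℚ) : Prop :=
  ∃ S : Set ℚ, AddSubmonoid.closure S = M ∧ ∃ B : ℤ, ∀ s ∈ S, s.num ≤ B

theorem PMAtom.mem_of_closure {S : Set ℚ} {a : ℚ} (ha : PMAtom (AddSubmonoid.closure S) a) :
    a ∈ S := by
  have key : ∀ x ∈ AddSubmonoid.closure S, x = 0 ∨ x ∈ S ∨
      ∃ y ∈ AddSubmonoid.closure S, ∃ z ∈ AddSubmonoid.closure S, y ≠ 0 ∧ z ≠ 0 ∧ x = y + z := by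
    intro x hx
    induction hx using AddSubmonoid.closure_induction with
    | mem x hx => exact .inr (.inl hx)
    | zero => exact .inl rfl
    | add x y hx hy ihx ihy =>
      by_cases hx0 : x = 0
      · simpa [hx0] using ihy
      by_cases hy0 : y = 0
      · simpa [hy0] using ihx
      exact .inr (.inr ⟨x, hx, y, hy, hx0, hy0, rfl⟩)
  obtain ⟨hmem, hne, hsplit⟩ := ha
  rcases key a hmem with h | h | ⟨y, hy, z, hz, hy0, hz0, h⟩
  · exact absurd h hne
  · exact h
  · exact ((hsplit y hy z hz h).elim hy0 hz0).elim

theorem nonneg_of_mem_closure {S : Set ℚ} (hS : ∀ s ∈ S, 0 ≤ s) {x : ℚ}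
    (hx : x ∈ AddSubmonoid.closure S) : 0 ≤ x := by
  induction hx using AddSubmonoid.closure_induction with
  | mem x hx => exact hS x hx
  | zero => exact le_rfl
  | add x y _ _ ihx ihy => exact add_nonneg ihx ihy

/-- An element of the monoid below the `n`-th generator only involves earlier generators, so
its denominator divides `p ^ n`. -/
theorem exists_nat_eq_of_lt_generator {p : ℕ} (hp : 0 < p) {a : ℕ → ℕ}
    (hmono : StrictMono fun n => (a n : ℚ) / (p : ℚ) ^ (n + 1)) {x : ℚ}
    (hx : x ∈ AddSubmonoid.closure {x : ℚ | ∃ n : ℕ, x = (a n : ℚ) / (p : ℚ) ^ (n + 1)})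
    {n : ℕ} (hlt : x < (a n : ℚ) / (p : ℚ) ^ (n + 1)) : ∃ k : ℕ, (p : ℚ) ^ n * x = k := by
  have hp0 : (p : ℚ) ≠ 0 := by positivity
  have hnonneg : ∀ s ∈ {x : ℚ | ∃ n : ℕ, x = (a n : ℚ) / (p : ℚ) ^ (n + 1)}, 0 ≤ s := by
    rintro s ⟨m, rfl⟩
    positivity
  induction hx using AddSubmonoid.closure_induction with
  | mem x hx =>
    obtain ⟨m, rfl⟩ := hx
    obtain ⟨d, rfl⟩ := Nat.exists_eq_add_of_lt (hmono.lt_iff_lt.mp hlt)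
    refine ⟨p ^ d * a m, ?_⟩
    push_cast
    field_simp
    ring
  | zero => exact ⟨0, by simp⟩
  | add x y hx hy ihx ihy =>
    have hx0 := nonneg_of_mem_closure hnonneg hx
    have hy0 := nonneg_of_mem_closure hnonneg hy
    obtain ⟨k, hk⟩ := ihx (by linarith)
    obtain ⟨l, hl⟩ := ihy (by linarith)
    exact ⟨k + l, by push_cast; rw [mul_add, hk, hl]⟩

theorem pmAtom_generator {p : ℕ} (hp : p.Prime) {a : ℕ → ℕ} (hpos : ∀ n, 0 < a n)
    (hcop : ∀ n, Nat.gcd (a n) p = 1)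
    (hmono : StrictMono fun n => (a n : ℚ) / (p : ℚ) ^ (n + 1)) (n : ℕ) :
    PMAtom (AddSubmonoid.closure {x : ℚ | ∃ n : ℕ, x = (a n : ℚ) / (p : ℚ) ^ (n + 1)})
      ((a n : ℚ) / (p : ℚ) ^ (n + 1)) := by
  have hp0 : (p : ℚ) ≠ 0 := Nat.cast_ne_zero.mpr hp.ne_zero
  have hnonneg : ∀ s ∈ {x : ℚ | ∃ n : ℕ, x = (a n : ℚ) / (p : ℚ) ^ (n + 1)}, 0 ≤ s := by
    rintro s ⟨m, rfl⟩
    positivity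
  refine ⟨AddSubmonoid.subset_closure ⟨n, rfl⟩,
    div_ne_zero (Nat.cast_ne_zero.mpr (hpos n).ne') (pow_ne_zero _ hp0), ?_⟩
  intro x hx y hy h
  by_contra! hne
  have hx0 := (nonneg_of_mem_closure hnonneg hx).lt_of_ne' hne.1
  have hy0 := (nonneg_of_mem_closure hnonneg hy).lt_of_ne' hne.2
  obtain ⟨k, hk⟩ := exists_nat_eq_of_lt_generator hp.pos hmono hx (n := n) (by linarith)
  obtain ⟨l, hl⟩ := exists_nat_eq_of_lt_generator hp.pos hmono hy (n := n) (by linarith)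
  have hsum : (a n : ℚ) = p * (k + l) := by
    rw [← hk, ← hl, ← mul_add, ← h]
    field_simp
    ring
  have hdvd : p ∣ a n := ⟨k + l, by exact_mod_cast hsum⟩
  exact hp.one_lt.ne' ((Nat.gcd_eq_right hdvd).symm.trans (hcop n))

theorem num_natCast_div_pow {a p : ℕ} (hp : 0 < p) (h : a.Coprime p) (n : ℕ) :
    ((a : ℚ) / (p : ℚ) ^ n).num = a := by
  have := Rat.num_div_eq_of_coprime (a := (a : ℤ)) (b := ((p ^ n : ℕ) : ℤ))
    (by exact_mod_cast pow_pos hp n) (by simpa using h.pow_right n)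
  push_cast at this
  exact this

/-- Let `p` be a prime and `{a_n}` a sequence of positive integers with
`a_1 > p`, `gcd(a_n, p) = 1` for all `n`, and `a_n / p^n < a_{n+1} / p^{n+1}` for all `n`
(here indexed from `0`, the `n`-th generator being `a_n / p^(n+1)`). Then the Puiseux monoid
`M = ⟨a_n / p^n : n⟩` satisfies `𝒜(M) = {a_n / p^n : n}`; in particular `M` is atomic,
has infinitely many atoms, and is not strongly bounded. -/
theorem atomic_not_strongly_bounded (p : ℕ) (hp : p.Prime) (a : ℕ → ℕ)
    (hpos : ∀ n, 0 < a n) (h1 : p < a 0)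
    (hcop : ∀ n, Nat.gcd (a n) p = 1)
    (hinc : ∀ n : ℕ, (a n : ℚ) / (p : ℚ) ^ (n + 1) < (a (n + 1) : ℚ) / (p : ℚ) ^ (n + 2))
    (M : AddSubmonoid ℚ)
    (hM : M = AddSubmonoid.closure {x : ℚ | ∃ n : ℕ, x = (a n : ℚ) / (p : ℚ) ^ (n + 1)}) :
    PMAtoms M = {x : ℚ | ∃ n : ℕ, x = (a n : ℚ) / (p : ℚ) ^ (n + 1)} ∧
    PMAtomic M ∧ (PMAtoms M).Infinite ∧ ¬ StronglyBounded M := by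
  have hmono : StrictMono fun n => (a n : ℚ) / (p : ℚ) ^ (n + 1) := strictMono_nat_of_lt_succ hinc
  have hatom := pmAtom_generator hp hpos hcop hmono
  rw [← hM] at hatom
  have hatoms : PMAtoms M = {x : ℚ | ∃ n : ℕ, x = (a n : ℚ) / (p : ℚ) ^ (n + 1)} := by
    refine Set.Subset.antisymm (fun x hx => ?_) ?_
    · subst hM
      exact PMAtom.mem_of_closure hx
    · rintro x ⟨n, rfl⟩
      exact hatom n
  refine ⟨hatoms, ?_, ?_, ?_⟩
  · intro m hm
    rw [hM] at hm
    obtain ⟨l, hl, hsum⟩ := AddSubmonoid.exists_multiset_of_mem_closure hm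
    refine ⟨l, fun x hx => ?_, hsum⟩
    obtain ⟨n, rfl⟩ := hl x hx
    exact hatom n
  · refine (Set.infinite_range_of_injective hmono.injective).mono ?_
    rintro x ⟨n, rfl⟩
    exact hatom n
  · rintro ⟨S, hS, B, hB⟩
    have hp0 : (0 : ℚ) < p := Nat.cast_pos.mpr hp.pos
    have hmem := hatom B.toNat
    rw [← hS] at hmem
    have hle := hB _ hmem.mem_of_closure
    rw [num_natCast_div_pow hp.pos (hcop _)] at hle
    have hone : (1 : ℚ) < a 0 / p ^ (0 + 1) := by
      rw [zero_add, pow_one, one_lt_div hp0]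
      exact_mod_cast h1
    have hgt := hone.trans_le (hmono.monotone (Nat.zero_le B.toNat))
    rw [one_lt_div (by positivity)] at hgt
    have hgt' : p ^ (B.toNat + 1) < a B.toNat := by exact_mod_cast hgt
    have hpow := Nat.lt_pow_self hp.one_lt (n := B.toNat + 1)
    omega
end

section
/- Let P be an infinite set of odd primes, and for each p ∈ P let S_p = {(p² + 1)/p + 1/2^n : n ∈ ℕ}, and let T = {1/2^n : n ∈ ℕ}. Then the Puiseux monoid M_P generated by T ∪ (⋃_{p∈P} S_p) is antimatter and is not bounded (hence not strongly bounded). Consequently, there exist infinitely many antimatter Puiseux monoids that are not strongly bounded. -/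
/-- `M` is a bounded Puiseux monoid: it can be generated by a bounded set of rationals. -/
def BoundedPM (M : AddSubmonoid ℚ) : Prop :=
  ∃ S : Set ℚ, AddSubmonoid.closure S = M ∧ ∃ B : ℚ, ∀ s ∈ S, s ≤ B

/-- The Puiseux monoid `M_P` generated by `{1/2^n} ∪ ⋃_{p ∈ P} {(p² + 1)/p + 1/2^n}`. -/
def primeReciprocalMonoid (P : Set ℕ) : AddSubmonoid ℚ :=
  AddSubmonoid.closure
    ({x : ℚ | ∃ n : ℕ, 0 < n ∧ x = 1 / 2 ^ n} ∪
     {x : ℚ | ∃ p ∈ P, ∃ n : ℕ, 0 < n ∧ x = ((p : ℚ) ^ 2 + 1) / (p : ℚ) + 1 / 2 ^ n})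

lemma Rat.prime_dvd_den_add {p : ℕ} (hp : p.Prime) {x y : ℚ} (h : p ∣ (x + y).den) :
    p ∣ x.den ∨ p ∣ y.den :=
  hp.dvd_mul.mp (h.trans (Rat.add_den_dvd x y))

lemma Rat.den_one_div_two_pow (n : ℕ) : (1 / 2 ^ n : ℚ).den = 2 ^ n := by
  have h := Rat.inv_natCast_den_of_pos (a := 2 ^ n) (by positivity)
  rw [one_div]
  exact_mod_cast h

lemma Nat.Prime.not_dvd_two_pow {p : ℕ} (hp : p.Prime) (hodd : Odd p) (n : ℕ) : ¬ p ∣ 2 ^ n := by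
  intro h
  have h2 := (Nat.prime_dvd_prime_iff_eq hp Nat.prime_two).mp (hp.dvd_of_dvd_pow h)
  subst h2
  exact absurd hodd (by decide)

lemma sq_add_one_div_eq {p : ℕ} (hp : p.Prime) :
    ((p : ℚ) ^ 2 + 1) / (p : ℚ) = (p : ℚ) + (p : ℚ)⁻¹ := by
  have : (p : ℚ) ≠ 0 := by exact_mod_cast hp.ne_zero
  field_simp

/-- A prime dividing the denominator of an element of `M_P` lies in `P` and bounds the element
from below. -/
lemma mem_primeReciprocalMonoid {P : Set ℕ} (hP : ∀ p ∈ P, Nat.Prime p) {p : ℕ}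
    (hp : p.Prime) (hodd : Odd p) {x : ℚ} (hx : x ∈ primeReciprocalMonoid P) :
    0 ≤ x ∧ (p ∣ x.den → p ∈ P ∧ (p : ℚ) ≤ x) := by
  induction hx using AddSubmonoid.closure_induction with
  | mem x hx =>
    rcases hx with ⟨n, -, rfl⟩ | ⟨q, hq, n, -, rfl⟩
    · refine ⟨by positivity, fun h => ?_⟩
      rw [Rat.den_one_div_two_pow] at h
      exact absurd h (hp.not_dvd_two_pow hodd n)
    · refine ⟨by positivity, fun h => ?_⟩
      rw [sq_add_one_div_eq (hP q hq)] at h ⊢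
      have hpq : p = q := by
        rcases Rat.prime_dvd_den_add hp h with h | h
        · rcases Rat.prime_dvd_den_add hp h with h | h
          · rw [Rat.den_natCast] at h
            exact absurd (Nat.dvd_one.mp h) hp.ne_one
          · rw [Rat.inv_natCast_den_of_pos (hP q hq).pos] at h
            exact (Nat.prime_dvd_prime_iff_eq hp (hP q hq)).mp h
        · rw [Rat.den_one_div_two_pow] at h
          exact absurd h (hp.not_dvd_two_pow hodd n)
      subst hpq
      have h1 : (0 : ℚ) ≤ (p : ℚ)⁻¹ := by positivity
      have h2 : (0 : ℚ) ≤ 1 / 2 ^ n := by positivity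
      exact ⟨hq, by linarith⟩
  | zero => exact ⟨le_rfl, fun h => absurd (Nat.dvd_one.mp h) hp.ne_one⟩
  | add x y _ _ hx hy =>
    refine ⟨add_nonneg hx.1 hy.1, fun h => ?_⟩
    rcases Rat.prime_dvd_den_add hp h with h | h
    · exact ⟨(hx.2 h).1, by linarith [(hx.2 h).2, hy.1]⟩
    · exact ⟨(hy.2 h).1, by linarith [(hy.2 h).2, hx.1]⟩

lemma isPuiseux_primeReciprocalMonoid {P : Set ℕ} (hP : ∀ p ∈ P, Nat.Prime p) :
    IsPuiseux (primeReciprocalMonoid P) := fun _ hx =>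
  (mem_primeReciprocalMonoid hP Nat.prime_three (by decide) hx).1

lemma one_div_two_pow_mem_primeReciprocalMonoid (P : Set ℕ) {n : ℕ} (hn : 0 < n) :
    (1 / 2 ^ n : ℚ) ∈ primeReciprocalMonoid P :=
  AddSubmonoid.subset_closure (Or.inl ⟨n, hn, rfl⟩)

lemma sq_add_one_div_add_mem_primeReciprocalMonoid {P : Set ℕ} {p : ℕ} (hp : p ∈ P) {n : ℕ}
    (hn : 0 < n) : ((p : ℚ) ^ 2 + 1) / (p : ℚ) + 1 / 2 ^ n ∈ primeReciprocalMonoid P :=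
  AddSubmonoid.subset_closure (Or.inr ⟨p, hp, n, hn, rfl⟩)

lemma prime_dvd_den_sq_add_one_div_add {p : ℕ} (hp : p.Prime) (hodd : Odd p) (n : ℕ) :
    p ∣ (((p : ℚ) ^ 2 + 1) / (p : ℚ) + 1 / 2 ^ n).den := by
  rw [sq_add_one_div_eq hp]
  have h : p ∣ (((p : ℚ) + (p : ℚ)⁻¹ + 1 / 2 ^ n) + (-(p : ℚ) + -(1 / 2 ^ n))).den := by
    have he : ((p : ℚ) + (p : ℚ)⁻¹ + 1 / 2 ^ n) + (-(p : ℚ) + -(1 / 2 ^ n)) = (p : ℚ)⁻¹ := by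
      ring
    rw [he, Rat.inv_natCast_den_of_pos hp.pos]
  rcases Rat.prime_dvd_den_add hp h with h | h
  · exact h
  rcases Rat.prime_dvd_den_add hp h with h | h
  · rw [Rat.den_neg_eq_den, Rat.den_natCast] at h
    exact absurd (Nat.dvd_one.mp h) hp.ne_one
  · rw [Rat.den_neg_eq_den, Rat.den_one_div_two_pow] at h
    exact absurd h (hp.not_dvd_two_pow hodd n)

lemma eq_zero_or_eq_add_of_mem_primeReciprocalMonoid {P : Set ℕ} {x : ℚ}
    (hx : x ∈ primeReciprocalMonoid P) :
    x = 0 ∨ ∃ y ∈ primeReciprocalMonoid P, ∃ z ∈ primeReciprocalMonoid P,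
      x = y + z ∧ y ≠ 0 ∧ z ≠ 0 := by
  induction hx using AddSubmonoid.closure_induction with
  | mem x hx =>
    right
    rcases hx with ⟨n, -, rfl⟩ | ⟨q, hq, n, -, rfl⟩
    · exact ⟨_, one_div_two_pow_mem_primeReciprocalMonoid P n.succ_pos,
        _, one_div_two_pow_mem_primeReciprocalMonoid P n.succ_pos,
        by rw [Nat.succ_eq_add_one, pow_succ]; field_simp; norm_num,
        by positivity, by positivity⟩
    · exact ⟨_, sq_add_one_div_add_mem_primeReciprocalMonoid hq n.succ_pos,
        _, one_div_two_pow_mem_primeReciprocalMonoid P n.succ_pos,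
        by rw [add_assoc, Nat.succ_eq_add_one, pow_succ]; congr 1; field_simp; norm_num [pow_succ],
        by positivity, by positivity⟩
  | zero => exact Or.inl rfl
  | add x y hxM hyM hx hy =>
    by_cases hx0 : x = 0
    · simpa [hx0] using hy
    by_cases hy0 : y = 0
    · simpa [hy0] using hx
    exact Or.inr ⟨x, hxM, y, hyM, rfl, hx0, hy0⟩

lemma PMAtoms_primeReciprocalMonoid (P : Set ℕ) : PMAtoms (primeReciprocalMonoid P) = ∅ := by
  refine Set.eq_empty_of_forall_notMem fun a ⟨ha, ha0, hatom⟩ => ?_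
  rcases eq_zero_or_eq_add_of_mem_primeReciprocalMonoid ha with h | ⟨y, hy, z, hz, h, hy0, hz0⟩
  · exact ha0 h
  · exact (hatom y hy z hz h).elim hy0 hz0

lemma StronglyBounded.boundedPM {M : AddSubmonoid ℚ} (hM : IsPuiseux M)
    (h : StronglyBounded M) : BoundedPM M := by
  obtain ⟨S, rfl, B, hB⟩ := h
  refine ⟨S, rfl, B, fun s hs => ?_⟩
  have h0 : 0 ≤ s := hM s (AddSubmonoid.subset_closure hs)
  have hd : (1 : ℚ) ≤ s.den := by exact_mod_cast s.pos
  calc s ≤ s * s.den := le_mul_of_one_le_right h0 hd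
    _ = s.num := Rat.mul_den_eq_num s
    _ ≤ B := by exact_mod_cast hB s hs

lemma not_boundedPM_primeReciprocalMonoid {P : Set ℕ} (hPinf : P.Infinite)
    (hP : ∀ p ∈ P, Nat.Prime p ∧ Odd p) : ¬ BoundedPM (primeReciprocalMonoid P) := by
  rintro ⟨S, hS, B, hB⟩
  obtain ⟨N, hN⟩ := exists_nat_gt B
  obtain ⟨p, hpP, hNp⟩ := hPinf.exists_gt N
  obtain ⟨hp, hodd⟩ := hP p hpP
  have hBp : B < p := hN.trans (by exact_mod_cast hNp)
  have hden : ∀ x ∈ AddSubmonoid.closure S, ¬ p ∣ x.den := by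
    intro x hx
    induction hx using AddSubmonoid.closure_induction with
    | mem x hx =>
      intro h
      have hxM : x ∈ primeReciprocalMonoid P := hS ▸ AddSubmonoid.subset_closure hx
      have := ((mem_primeReciprocalMonoid (fun q hq => (hP q hq).1) hp hodd hxM).2 h).2
      linarith [hB x hx]
    | zero => exact fun h => hp.ne_one (Nat.dvd_one.mp h)
    | add x y _ _ hx hy => exact fun h => (Rat.prime_dvd_den_add hp h).elim hx hy
  exact hden _ (hS ▸ sq_add_one_div_add_mem_primeReciprocalMonoid hpP one_pos)
    (prime_dvd_den_sq_add_one_div_add hp hodd 1)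

lemma primeReciprocalMonoid_diff_singleton_injOn {P : Set ℕ}
    (hP : ∀ p ∈ P, Nat.Prime p ∧ Odd p) :
    Set.InjOn (fun p => primeReciprocalMonoid (P \ {p})) P := by
  intro p hp q _ hpq
  by_contra hne
  have hmem := sq_add_one_div_add_mem_primeReciprocalMonoid
    (show p ∈ P \ {q} from ⟨hp, hne⟩) one_pos
  rw [← show primeReciprocalMonoid (P \ {p}) = primeReciprocalMonoid (P \ {q}) from hpq] at hmem
  have h := (mem_primeReciprocalMonoid (fun r hr => (hP r hr.1).1) (hP p hp).1 (hP p hp).2 hmem).2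
    (prime_dvd_den_sq_add_one_div_add (hP p hp).1 (hP p hp).2 1)
  exact h.1.2 rfl

/-- For an infinite set `P` of odd primes, the Puiseux monoid `M_P` generated by
`{1/2^n : n ∈ ℕ} ∪ ⋃_{p ∈ P} {(p² + 1)/p + 1/2^n : n ∈ ℕ}` is antimatter and not bounded
(hence not strongly bounded). Consequently, there are infinitely many antimatter Puiseux
monoids that are not strongly bounded. -/
theorem antimatter_not_strongly_bounded (P : Set ℕ) (hPinf : P.Infinite)
    (hP : ∀ p ∈ P, Nat.Prime p ∧ Odd p)
    (M : AddSubmonoid ℚ)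
    (hM : M = AddSubmonoid.closure
      ({x : ℚ | ∃ n : ℕ, 0 < n ∧ x = 1 / 2 ^ n} ∪
       {x : ℚ | ∃ p ∈ P, ∃ n : ℕ, 0 < n ∧ x = ((p : ℚ) ^ 2 + 1) / (p : ℚ) + 1 / 2 ^ n})) :
    (PMAtoms M = ∅ ∧ ¬ BoundedPM M ∧ ¬ StronglyBounded M) ∧
    {M' : AddSubmonoid ℚ | IsPuiseux M' ∧ PMAtoms M' = ∅ ∧ ¬ StronglyBounded M'}.Infinite := by
  have not_strong : ∀ Q ⊆ P, Q.Infinite → ¬ StronglyBounded (primeReciprocalMonoid Q) :=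
    fun Q hQ hQinf h => not_boundedPM_primeReciprocalMonoid hQinf (fun q hq => hP q (hQ hq))
      (h.boundedPM (isPuiseux_primeReciprocalMonoid fun q hq => (hP q (hQ hq)).1))
  change M = primeReciprocalMonoid P at hM
  subst hM
  refine ⟨⟨PMAtoms_primeReciprocalMonoid P, not_boundedPM_primeReciprocalMonoid hPinf hP,
    not_strong P subset_rfl hPinf⟩, ?_⟩
  refine Set.infinite_of_injOn_mapsTo (primeReciprocalMonoid_diff_singleton_injOn hP) ?_ hPinf
  intro p _
  exact ⟨isPuiseux_primeReciprocalMonoid fun q hq => (hP q hq.1).1,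
    PMAtoms_primeReciprocalMonoid _,
    not_strong _ Set.sdiff_subset (hPinf.sdiff (Set.finite_singleton p))⟩
end

section
/- Let {a_n} be a sequence of positive integers bounded above by B. If the spectrum of {a_n} is empty, then for each N ∈ ℕ there exist k ≤ B + 1 and indices n_1, …, n_k ∈ ℕ with N < n_1 < … < n_k and gcd(a_{n_1}, …, a_{n_k}) = 1. -/
/-- A sequence `{a_n}` of integers stabilizes at `d` if `d ∣ a_n` for all large `n`. -/
def Stabilizes (a : ℕ → ℕ) (d : ℕ) : Prop := ∃ N : ℕ, ∀ n ≥ N, d ∣ a n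

/-- Let `{a_n}` be a sequence of positive integers bounded above by `B`.
If the spectrum of `{a_n}` is empty (no prime stabilizes the sequence), then for each
`N ∈ ℕ` there exist `k ≤ B + 1` and indices `N < n_1 < … < n_k` with
`gcd(a_{n_1}, …, a_{n_k}) = 1`. -/
theorem empty_spectrum_coprime_indices (a : ℕ → ℕ) (B : ℕ)
    (hpos : ∀ n, 0 < a n) (hbd : ∀ n, a n ≤ B)
    (hspec : ∀ p : ℕ, p.Prime → ¬ Stabilizes a p) :
    ∀ N : ℕ, ∃ k : ℕ, k ≤ B + 1 ∧ ∃ idx : Fin k → ℕ,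
      StrictMono idx ∧ (∀ i, N < idx i) ∧
      Finset.univ.gcd (fun i => a (idx i)) = 1 := by
  intro N
  have escape : ∀ p : ℕ, ∃ n, N < n ∧ (p.Prime → ¬ p ∣ a n) := by
    intro p
    by_cases hp : p.Prime
    · by_contra! h
      exact hspec p hp ⟨N + 1, fun n hn => (h n hn).2⟩
    · exact ⟨N + 1, N.lt_succ_self, fun h => absurd h hp⟩
  choose f hfN hf using escape
  let S : Finset ℕ := insert (N + 1) ((Finset.Icc 1 B).image f)
  have hcard : S.card ≤ B + 1 := by
    refine (Finset.card_insert_le _ _).trans ?_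
    simpa using (Finset.card_image_le (s := Finset.Icc 1 B) (f := f))
  have hS : ∀ n ∈ S, N < n := by
    intro n hn
    rcases Finset.mem_insert.1 hn with rfl | hn
    · exact N.lt_succ_self
    · obtain ⟨p, -, rfl⟩ := Finset.mem_image.1 hn
      exact hfN p
  refine ⟨S.card, hcard, S.orderEmbOfFin rfl, (S.orderEmbOfFin rfl).strictMono,
    fun i => hS _ (S.orderEmbOfFin_mem rfl i), ?_⟩
  by_contra hne
  obtain ⟨p, hp, hdvd⟩ := Nat.exists_prime_and_dvd hne
  have hall : ∀ n ∈ S, p ∣ a n := by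
    intro n hn
    have hmem : n ∈ Set.range (S.orderEmbOfFin rfl) := by
      rwa [Finset.range_orderEmbOfFin]
    obtain ⟨i, rfl⟩ := hmem
    exact hdvd.trans (Finset.gcd_dvd (Finset.mem_univ i))
  have hpB : p ≤ B :=
    (Nat.le_of_dvd (hpos _) (hall _ (Finset.mem_insert_self _ _))).trans (hbd _)
  exact hf p hp (hall _ (Finset.mem_insert_of_mem
    (Finset.mem_image_of_mem f (Finset.mem_Icc.2 ⟨hp.one_le, hpB⟩))))
end

section
/- Let M be a Puiseux monoid generated by a set {r_n : n ∈ ℕ} of positive rationals whose numerator set {n(r_n) : n ∈ ℕ} is bounded. If d(r_n) divides d(r_{n+1}) for every n ∈ ℕ, the sequence {d(r_n)} is unbounded, and the spectrum of the sequence {n(r_n)} is empty, then M is antimatter. -/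
/-- A sequence `{a_n}` of integers stabilizes at `d` if `d ∣ a_n` for all large `n`. -/
def StabilizesInt (a : ℕ → ℤ) (d : ℤ) : Prop := ∃ N : ℕ, ∀ n ≥ N, d ∣ a n

/-- A nonzero element of the monoid generated by `r` has some `r k` as a summand. -/
lemma eq_zero_or_eq_add_of_mem_closure_range {r : ℕ → ℚ} {a : ℚ}
    (ha : a ∈ AddSubmonoid.closure (Set.range r)) :
    a = 0 ∨ ∃ k, ∃ y ∈ AddSubmonoid.closure (Set.range r), a = r k + y := by
  induction ha using AddSubmonoid.closure_induction with
  | mem x hx =>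
    obtain ⟨k, rfl⟩ := hx
    exact Or.inr ⟨k, 0, zero_mem _, (add_zero _).symm⟩
  | zero => exact Or.inl rfl
  | add x y _ hy ihx ihy =>
    rcases ihx with rfl | ⟨k, z, hz, rfl⟩
    · simpa using ihy
    · exact Or.inr ⟨k, z + y, add_mem hz hy, add_assoc _ _ _⟩

/-- Let `P` be a finite set of primes containing all prime factors `p` of `s`, none of which
divides the corresponding `b p`. Then `∑ p ∈ P, (∏ q ∈ P.erase p, q) * b p` is coprime to `s`. -/
lemma isCoprime_sum_prod_erase {P : Finset ℕ} (hP : ∀ p ∈ P, p.Prime) {s : ℤ} {b : ℕ → ℤ}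
    (hs : ∀ p : ℕ, p.Prime → (p : ℤ) ∣ s → p ∈ P ∧ ¬ (p : ℤ) ∣ b p) :
    IsCoprime (∑ p ∈ P, ((∏ q ∈ P.erase p, q : ℕ) : ℤ) * b p) s := by
  rw [Int.isCoprime_iff_gcd_eq_one]
  by_contra hne
  obtain ⟨p, hp, hpd⟩ := Nat.exists_prime_and_dvd hne
  have hps : (p : ℤ) ∣ s := (Int.natCast_dvd_natCast.2 hpd).trans (Int.gcd_dvd_right _ _)
  have hpe := (Int.natCast_dvd_natCast.2 hpd).trans (Int.gcd_dvd_left _ _)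
  obtain ⟨hpP, hpb⟩ := hs p hp hps
  rw [← Finset.add_sum_erase _ _ hpP] at hpe
  have hrest : (p : ℤ) ∣ ∑ q ∈ P.erase p, ((∏ l ∈ P.erase q, l : ℕ) : ℤ) * b q := by
    refine Finset.dvd_sum fun q hq => Dvd.dvd.mul_right ?_ _
    have hqp := (Finset.mem_erase.1 hq).1
    exact Int.natCast_dvd_natCast.2
      (Finset.dvd_prod_of_mem _ (Finset.mem_erase.2 ⟨hqp.symm, hpP⟩))
  rw [dvd_add_left hrest] at hpe
  rcases (Nat.prime_iff_prime_int.1 hp).dvd_or_dvd hpe with h | h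
  · obtain ⟨q, hq, hpq⟩ := (hp.prime.dvd_finsetProd_iff _).1 (Int.natCast_dvd_natCast.1 h)
    obtain ⟨hqp, hqP⟩ := Finset.mem_erase.1 hq
    exact hqp ((Nat.prime_dvd_prime_iff_eq hp (hP q hqP)).1 hpq).symm
  · exact hpb h

/-- If `e` is coprime to `s > 0`, every integer is congruent to `c * e` modulo `s` for some
`0 ≤ c < s`. -/
lemma exists_eq_mul_add_mul_of_isCoprime {e s : ℤ} (h : IsCoprime e s) (hs : 0 < s) (t : ℤ) :
    ∃ c : ℕ, ∃ m : ℤ, (c : ℤ) < s ∧ t = c * e + m * s := by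
  obtain ⟨u, v, huv⟩ := h
  refine ⟨(t * u % s).toNat, t * v + t * u / s * e, ?_, ?_⟩ <;>
    rw [Int.toNat_of_nonneg (Int.emod_nonneg _ hs.ne')]
  · exact Int.emod_lt_of_pos _ hs
  · linear_combination (-t) * huv - e * (Int.emod_add_mul_ediv (t * u) s)

lemma Rat.eq_num_mul_div_den_div {q : ℚ} {D : ℕ} (hD : D ≠ 0) (h : q.den ∣ D) :
    q = (q.num * (D / q.den : ℕ) : ℤ) / (D : ℚ) := by
  obtain ⟨t, rfl⟩ := h
  have ht : (t : ℚ) ≠ 0 := by exact_mod_cast right_ne_zero_of_mul hD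
  have hq : (q.den : ℚ) ≠ 0 := by exact_mod_cast q.den_nz
  rw [Nat.mul_div_cancel_left _ q.den_pos]
  push_cast
  rw [mul_div_mul_right _ _ ht, Rat.num_div_den]

/-- Every generator splits off a strictly smaller generator inside the monoid. -/
lemma exists_eq_add_of_empty_spectrum {r : ℕ → ℚ} (hpos : ∀ n, 0 < r n)
    (hnum : ∃ B : ℤ, ∀ n, (r n).num ≤ B)
    (hdvd : ∀ n, (r n).den ∣ (r (n + 1)).den)
    (hunbd : ∀ B : ℕ, ∃ n, B < (r n).den)
    (hspec : ∀ p : ℕ, p.Prime → ¬ StabilizesInt (fun n => (r n).num) (p : ℤ)) (k : ℕ) :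
    ∃ N, ∃ y ∈ AddSubmonoid.closure (Set.range r), r N < r k ∧ r k = r N + y := by
  obtain ⟨B, hB⟩ := hnum
  have hdvd' : ∀ {m n}, m ≤ n → (r m).den ∣ (r n).den := fun h =>
    Nat.le_induction dvd_rfl (fun n _ ih => ih.trans (hdvd n)) _ h
  have hnumpos : ∀ n, 0 < (r n).num := fun n => Rat.num_pos.2 (hpos n)
  have hB0 : (0 : ℚ) < B := by exact_mod_cast (hnumpos 0).trans_le (hB 0)
  let P : Finset ℕ := (Finset.range (B.toNat + 1)).filter Nat.Prime
  have hP : ∀ p ∈ P, p.Prime := fun p hp => (Finset.mem_filter.1 hp).2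
  let w : ℕ → ℕ := fun p => ∏ q ∈ P.erase p, q
  let W : ℕ := ∑ p ∈ P, w p
  obtain ⟨n₀, hk, hn₀⟩ : ∃ n₀, k ≤ n₀ ∧ (B : ℚ) * W * B + B < (r n₀).den * r k := by
    obtain ⟨A, hA⟩ := exists_nat_gt (((B : ℚ) * W * B + B) / r k)
    obtain ⟨n, hn⟩ := hunbd A
    refine ⟨max k n, le_max_left _ _, ?_⟩
    rw [← div_lt_iff₀ (hpos k)]
    have := Nat.le_of_dvd (r (max k n)).den_pos (hdvd' (le_max_right k n))
    exact hA.trans (by exact_mod_cast hn.trans_le this)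
  have hd₀ : (0 : ℚ) < (r n₀).den := by exact_mod_cast (r n₀).den_pos
  have hsmall : ∀ n, n₀ ≤ n → r n ≤ B / (r n₀).den := fun n hn => by
    have h1 : ((r n₀).den : ℚ) ≤ (r n).den := by
      exact_mod_cast Nat.le_of_dvd (r n).den_pos (hdvd' hn)
    have h2 : ((r n).num : ℚ) ≤ B := by exact_mod_cast hB n
    calc r n = (r n).num / (r n).den := (Rat.num_div_den _).symm
      _ ≤ B / (r n₀).den := by gcongr
  have hf : ∀ p : ℕ, ∃ n, n₀ ≤ n ∧ (p.Prime → ¬ (p : ℤ) ∣ (r n).num) := fun p => by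
    by_cases hp : p.Prime
    · have := hspec p hp
      simp only [StabilizesInt, not_exists, not_forall] at this
      obtain ⟨n, hn, h⟩ := this n₀
      exact ⟨n, hn, fun _ => h⟩
    · exact ⟨n₀, le_rfl, fun h => absurd h hp⟩
  choose f hfn hfp using hf
  let N := max n₀ (P.sup f)
  have hfN : ∀ p ∈ P, f p ≤ N := fun p hp => (Finset.le_sup hp).trans (le_max_right _ _)
  let D := (r N).den
  have hD : D ≠ 0 := (r N).den_nz
  let b : ℕ → ℤ := fun p => (r (f p)).num * (D / (r (f p)).den : ℕ)
  have hcop : IsCoprime (∑ p ∈ P, (w p : ℤ) * b p) (r N).num := by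
    refine isCoprime_sum_prod_erase hP fun p hp hps => ?_
    have hpP : p ∈ P := by
      have := (Int.le_of_dvd (hnumpos N) hps).trans (hB N)
      exact Finset.mem_filter.2 ⟨Finset.mem_range.2 (by omega), hp⟩
    refine ⟨hpP, fun hpb => ?_⟩
    rcases (Nat.prime_iff_prime_int.1 hp).dvd_or_dvd hpb with h | h
    · exact hfp p hp h
    · have hpD : p ∣ D :=
        (Int.natCast_dvd_natCast.1 h).trans (Nat.div_dvd_of_dvd (hdvd' (hfN p hpP)))
      exact Nat.not_coprime_of_dvd_of_dvd hp.one_lt (Int.natCast_dvd.1 hps) hpD (r N).reduced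
  obtain ⟨c, m, hc, hcm⟩ := exists_eq_mul_add_mul_of_isCoprime hcop (hnumpos N)
    ((r k).num * (D / (r k).den : ℕ))
  let x : ℚ := ∑ p ∈ P, w p • r (f p)
  have hx : x = (∑ p ∈ P, (w p : ℤ) * b p : ℤ) / (D : ℚ) := by
    rw [Int.cast_sum, Finset.sum_div]
    refine Finset.sum_congr rfl fun p hp => ?_
    rw [nsmul_eq_mul, Int.cast_mul, Int.cast_natCast, mul_div_assoc,
      ← Rat.eq_num_mul_div_den_div hD (hdvd' (hfN p hp))]
  have hdecomp : r k = c * x + m * r N := by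
    rw [Rat.eq_num_mul_div_den_div hD (hdvd' (hk.trans (le_max_left _ _) : k ≤ N)), hcm, hx]
    have hrN : r N = (r N).num / (D : ℚ) := (Rat.num_div_den _).symm
    conv_rhs => rw [hrN]
    push_cast
    ring
  have hxW : x ≤ W * (B / (r n₀).den) := by
    simp only [x, W, Nat.cast_sum, Finset.sum_mul, nsmul_eq_mul]
    gcongr with p hp
    exact hsmall _ (hfn p)
  have hcB : (c : ℚ) ≤ B := by exact_mod_cast hc.le.trans (hB N)
  have hbound : B * (W * (B / (r n₀).den)) + B / (r n₀).den < r k := by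
    rw [← mul_lt_mul_iff_right₀ hd₀]
    refine lt_of_eq_of_lt ?_ hn₀
    field_simp
  have hδ : (0 : ℚ) ≤ B / (r n₀).den := by positivity
  have hx0 : 0 ≤ x := Finset.sum_nonneg fun p _ => nsmul_nonneg (hpos _).le _
  have hcx : (c : ℚ) * x ≤ B * (W * (B / (r n₀).den)) := by gcongr
  have hm : 0 < m := by
    have : 0 < (m : ℚ) * r N := by linarith
    exact_mod_cast pos_of_mul_pos_left this (hpos N).le
  have hmem : ∀ n, r n ∈ AddSubmonoid.closure (Set.range r) := fun n =>
    AddSubmonoid.subset_closure ⟨n, rfl⟩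
  refine ⟨N, c • x + (m - 1).toNat • r N, ?_, ?_, ?_⟩
  · exact add_mem (nsmul_mem (sum_mem fun p _ => nsmul_mem (hmem _) _) _) (nsmul_mem (hmem _) _)
  · have : (0 : ℚ) ≤ B * (W * (B / (r n₀).den)) := by positivity
    linarith [hsmall N (le_max_left _ _)]
  · have : (((m - 1).toNat : ℕ) : ℚ) = m - 1 := by
      rw [← Int.cast_natCast, Int.toNat_of_nonneg (by omega)]
      push_cast
      rfl
    rw [nsmul_eq_mul, nsmul_eq_mul, this]
    linear_combination hdecomp

/-- Let `M` be a Puiseux monoid generated by `{r_n : n ∈ ℕ}`, positive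
rationals with bounded numerators. If `d(r_n) ∣ d(r_{n+1})` for all `n`, `{d(r_n)}` is
unbounded, and the spectrum of `{n(r_n)}` is empty, then `M` is antimatter. -/
theorem antimatter_of_empty_spectrum (r : ℕ → ℚ) (hpos : ∀ n, 0 < r n)
    (hnum : ∃ B : ℤ, ∀ n, (r n).num ≤ B)
    (hdvd : ∀ n, (r n).den ∣ (r (n + 1)).den)
    (hunbd : ∀ B : ℕ, ∃ n, B < (r n).den)
    (hspec : ∀ p : ℕ, p.Prime → ¬ StabilizesInt (fun n => (r n).num) (p : ℤ))
    (M : AddSubmonoid ℚ) (hM : M = AddSubmonoid.closure (Set.range r)) :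
    PMAtoms M = ∅ := by
  subst hM
  refine Set.eq_empty_iff_forall_notMem.2 fun a ⟨ha, ha0, hatom⟩ => ?_
  rcases eq_zero_or_eq_add_of_mem_closure_range ha with rfl | ⟨k, z, hz, hkz⟩
  · exact ha0 rfl
  have hmem : ∀ n, r n ∈ AddSubmonoid.closure (Set.range r) := fun n =>
    AddSubmonoid.subset_closure ⟨n, rfl⟩
  have hak : a = r k := by
    rcases hatom _ (hmem k) z hz hkz with h | h
    · exact absurd h (hpos k).ne'
    · rw [hkz, h, add_zero]
  obtain ⟨N, y, hy, hlt, hNy⟩ := exists_eq_add_of_empty_spectrum hpos hnum hdvd hunbd hspec k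
  rcases hatom _ (hmem N) y hy (hak.trans hNy) with h | h
  · exact (hpos N).ne' h
  · exact hlt.ne (by rw [hNy, h, add_zero])
end

section
/- Let M be a Puiseux monoid generated by a set {r_n : n ∈ ℕ} of positive rationals whose numerator set {n(r_n) : n ∈ ℕ} is bounded, such that d(r_n) divides d(r_{n+1}) for every n ∈ ℕ, the sequence {d(r_n)} is unbounded, and the spectrum of {n(r_n)} is empty. Then M = {m / d(r_n) : m ∈ ℕ₀, n ∈ ℕ}. -/
open Filter in
/-- A bounded sequence of naturals eventually takes only values that it takes infinitely often. -/
theorem eventually_frequently_eq_of_bounded (a : ℕ → ℕ) (B : ℕ) (ha : ∀ n, a n ≤ B) :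
    ∀ᶠ n in atTop, ∃ᶠ k in atTop, a k = a n := by
  have h : ∀ᶠ n in atTop, ∀ b ∈ Finset.range (B + 1),
      (¬ ∃ᶠ k in atTop, a k = b) → a n ≠ b := by
    rw [Finset.eventually_all]
    intro b _
    by_cases hb : ∃ᶠ k in atTop, a k = b
    · simp [hb]
    · exact (not_frequently.1 hb).mono fun _ h _ => h
  filter_upwards [h] with n hn
  by_contra hc
  exact hn (a n) (by simpa [Nat.lt_succ_iff] using ha n) hc rfl

/-- If `a / D` lies in an additive submonoid of `ℚ` and `d ∣ D`, then so does `a / d`. -/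
theorem div_mem_of_dvd {M : AddSubmonoid ℚ} {a : ℚ} {d D : ℕ} (hD : D ≠ 0) (hd : d ∣ D)
    (h : a / D ∈ M) : a / d ∈ M := by
  obtain ⟨e, rfl⟩ := hd
  have hd0 : (d : ℚ) ≠ 0 := by exact_mod_cast left_ne_zero_of_mul hD
  have he0 : (e : ℚ) ≠ 0 := by exact_mod_cast right_ne_zero_of_mul hD
  have key : a / d = e • (a / ((d * e : ℕ) : ℚ)) := by
    rw [nsmul_eq_mul]
    push_cast
    field_simp
  rw [key]
  exact M.nsmul_mem h e

/-- Let `M` be a Puiseux monoid generated by `{r_n : n ∈ ℕ}`, positive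
rationals with bounded numerators, such that `d(r_n) ∣ d(r_{n+1})` for all `n`, `{d(r_n)}`
is unbounded, and the spectrum of `{n(r_n)}` is empty. Then
`M = {m / d(r_n) : m ∈ ℕ₀, n ∈ ℕ}`. -/
theorem full_description_of_empty_spectrum_monoid (r : ℕ → ℚ) (hpos : ∀ n, 0 < r n)
    (hnum : ∃ B : ℤ, ∀ n, (r n).num ≤ B)
    (hdvd : ∀ n, (r n).den ∣ (r (n + 1)).den)
    (hunbd : ∀ B : ℕ, ∃ n, B < (r n).den)
    (hspec : ∀ p : ℕ, p.Prime → ¬ StabilizesInt (fun n => (r n).num) (p : ℤ))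
    (M : AddSubmonoid ℚ) (hM : M = AddSubmonoid.closure (Set.range r)) :
    (M : Set ℚ) = {x : ℚ | ∃ m : ℕ, ∃ n : ℕ, x = (m : ℚ) / ((r n).den : ℚ)} := by
  subst hM
  obtain ⟨B, hB⟩ := hnum
  set M := AddSubmonoid.closure (Set.range r)
  let a : ℕ → ℕ := fun n => (r n).num.toNat
  have ha (n : ℕ) : ((a n : ℕ) : ℤ) = (r n).num :=
    Int.toNat_of_nonneg (Rat.num_nonneg.2 (hpos n).le)
  have hr (n : ℕ) : r n = (a n : ℚ) / ((r n).den : ℚ) := by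
    have h : ((a n : ℕ) : ℚ) = ((r n).num : ℚ) := by
      exact_mod_cast congrArg (Int.cast (R := ℚ)) (ha n)
    rw [h, Rat.num_div_den]
  have hmono {m n : ℕ} (h : m ≤ n) : (r m).den ∣ (r n).den :=
    Nat.le_induction dvd_rfl (fun k _ ih => ih.trans (hdvd k)) n h
  let S : Set ℕ := {b | ∃ᶠ k in Filter.atTop, a k = b}
  have hgcd : Nat.setGcd S = 1 := by
    by_contra hne
    obtain ⟨p, hp, hpS⟩ := Nat.exists_prime_and_dvd hne
    refine hspec p hp ?_
    obtain ⟨N, hN⟩ := Filter.eventually_atTop.1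
      (eventually_frequently_eq_of_bounded a B.toNat fun n => Int.toNat_le_toNat (hB n))
    refine ⟨N, fun n hn => ?_⟩
    change (p : ℤ) ∣ (r n).num
    rw [← ha n]
    exact_mod_cast hpS.trans (Nat.setGcd_dvd_of_mem (hN n hn))
  have hSM (k : ℕ) {b : ℕ} (hb : b ∈ S) : (b : ℚ) / ((r k).den : ℚ) ∈ M := by
    obtain ⟨n, hn, rfl⟩ := Filter.frequently_atTop.1 hb k
    refine div_mem_of_dvd (r n).den_nz (hmono hn) ?_
    rw [← hr n]
    exact AddSubmonoid.subset_closure ⟨n, rfl⟩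
  have hclosure (k : ℕ) {b : ℕ} (hb : b ∈ AddSubmonoid.closure S) :
      (b : ℚ) / ((r k).den : ℚ) ∈ M := by
    induction hb using AddSubmonoid.closure_induction with
    | mem x hx => exact hSM k hx
    | zero => simp
    | add x y _ _ hx hy => simpa [add_div] using M.add_mem hx hy
  obtain ⟨F, hF⟩ := Nat.exists_mem_closure_of_ge S
  have hunit (n : ℕ) : (1 : ℚ) / ((r n).den : ℚ) ∈ M := by
    obtain ⟨k, hk⟩ := hunbd (F * (r n).den)
    have hkm : (r k).den ≤ (r (max n k)).den :=
      Nat.le_of_dvd (r _).den_pos (hmono (le_max_right n k))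
    obtain ⟨e, he⟩ := hmono (le_max_left n k)
    have hFe : F ≤ e := by
      have : F * (r n).den < e * (r n).den := by
        rw [mul_comm e, ← he]; exact hk.trans_le hkm
      exact (Nat.lt_of_mul_lt_mul_right this).le
    have h := hclosure (max n k) (hF e hFe (hgcd ▸ one_dvd e))
    have he0 : (e : ℚ) ≠ 0 := by
      rintro h0
      exact (r (max n k)).den_nz (by rw [he, Nat.cast_eq_zero.1 h0, mul_zero])
    have key : (e : ℚ) / ((r (max n k)).den : ℚ) = 1 / ((r n).den : ℚ) := by
      have hd : ((r n).den : ℚ) ≠ 0 := by exact_mod_cast (r n).den_nz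
      rw [he, Nat.cast_mul]
      field_simp
    rwa [key] at h
  ext x
  constructor
  · intro hx
    induction hx using AddSubmonoid.closure_induction with
    | mem x hx =>
      obtain ⟨n, rfl⟩ := hx
      exact ⟨a n, n, hr n⟩
    | zero => exact ⟨0, 0, by simp⟩
    | add x y _ _ hx hy =>
      obtain ⟨m₁, n₁, rfl⟩ := hx
      obtain ⟨m₂, n₂, rfl⟩ := hy
      obtain ⟨e₁, h₁⟩ := hmono (le_max_left n₁ n₂)
      obtain ⟨e₂, h₂⟩ := hmono (le_max_right n₁ n₂)
      refine ⟨m₁ * e₁ + m₂ * e₂, max n₁ n₂, ?_⟩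
      have h₀ : ((r (max n₁ n₂)).den : ℚ) ≠ 0 := by exact_mod_cast (r _).den_nz
      have hd₁ : ((r n₁).den : ℚ) ≠ 0 := by exact_mod_cast (r _).den_nz
      have hd₂ : ((r n₂).den : ℚ) ≠ 0 := by exact_mod_cast (r _).den_nz
      have h₁' : ((r (max n₁ n₂)).den : ℚ) = (r n₁).den * e₁ := by exact_mod_cast h₁
      have h₂' : ((r (max n₁ n₂)).den : ℚ) = (r n₂).den * e₂ := by exact_mod_cast h₂
      rw [eq_div_iff h₀, add_mul]
      nth_rewrite 1 [h₁']
      rw [h₂']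
      push_cast
      field_simp
  · rintro ⟨m, n, rfl⟩
    simpa [div_eq_mul_inv] using M.nsmul_mem (hunit n) m
end

section
/- Let k ∈ ℕ, let P = {p_1, …, p_k} be a set of k distinct primes, and let {s_n} be a sequence of positive integers such that every prime divisor of every s_n belongs to P. Then there exists N ∈ ℕ with the following property: whenever there exist n ∈ ℕ and I ⊆ {1, …, k} such that v_{p_i}(s_n) > N for each i ∈ I, the sequence {s_n} has a subsequence {s'_n} such that {v_{p_i}(s'_n)} is strictly increasing for each i ∈ I. -/
/-- If the functions `v i`, `i ∈ I`, simultaneously take arbitrarily large values, then they are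
simultaneously strictly increasing along a common subsequence. -/
theorem exists_common_strictMono_subsequence {ι : Type*} [Fintype ι] (v : ι → ℕ → ℕ) (I : Set ι)
    (h : ∀ N, ∃ n, ∀ i ∈ I, N < v i n) :
    ∃ φ : ℕ → ℕ, StrictMono φ ∧ ∀ i ∈ I, StrictMono (fun m => v i (φ m)) := by
  rcases I.eq_empty_or_nonempty with rfl | ⟨i₀, hi₀⟩
  · exact ⟨id, strictMono_id, by simp⟩
  have step : ∀ m, ∃ n, m < n ∧ ∀ i ∈ I, v i m < v i n := by
    intro m
    obtain ⟨n, hn⟩ := h (∑ j ∈ Finset.range (m + 1), ∑ i, v i j)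
    have bound : ∀ j ≤ m, ∀ i, v i j ≤ ∑ j ∈ Finset.range (m + 1), ∑ i, v i j := fun j hj i =>
      (Finset.single_le_sum (f := fun i => v i j) (fun _ _ => Nat.zero_le _)
        (Finset.mem_univ i)).trans
      (Finset.single_le_sum (f := fun j => ∑ i, v i j) (fun _ _ => Nat.zero_le _)
        (Finset.mem_range.2 (Nat.lt_succ_of_le hj)))
    refine ⟨n, ?_, fun i hi => (bound m le_rfl i).trans_lt (hn i hi)⟩
    by_contra! hnm
    exact (bound n hnm i₀).not_gt (hn i₀ hi₀)
  choose g hg hgv using step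
  have iterate_succ : ∀ m, g^[m + 1] 0 = g (g^[m] 0) := fun m =>
    Function.iterate_succ_apply' g m 0
  refine ⟨fun m => g^[m] 0, strictMono_nat_of_lt_succ fun m => ?_,
    fun i hi => strictMono_nat_of_lt_succ fun m => ?_⟩
  · simpa only [iterate_succ] using hg (g^[m] 0)
  · simpa only [iterate_succ] using hgv (g^[m] 0) i hi

/-- Let `P = {p_1, …, p_k}` be `k` distinct primes and `{s_n}` a sequence of
positive integers all of whose prime divisors lie in `P`. Then there is `N ∈ ℕ` such that:
whenever there are `n ∈ ℕ` and `I ⊆ {1, …, k}` with `v_{p_i}(s_n) > N` for each `i ∈ I`,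
the sequence `{s_n}` has a subsequence on which `v_{p_i}` is strictly increasing for each
`i ∈ I`. -/
theorem common_bound_for_increasing_valuations (k : ℕ) (p : Fin k → ℕ)
    (hp : ∀ i, (p i).Prime) (hinj : Function.Injective p)
    (s : ℕ → ℕ) (hs : ∀ n, 0 < s n)
    (hdiv : ∀ n, ∀ q : ℕ, q.Prime → q ∣ s n → ∃ i, p i = q) :
    ∃ N : ℕ, ∀ n : ℕ, ∀ I : Set (Fin k),
      (∀ i ∈ I, N < padicValNat (p i) (s n)) →
      ∃ φ : ℕ → ℕ, StrictMono φ ∧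
        ∀ i ∈ I, StrictMono (fun m => padicValNat (p i) (s (φ m))) := by
  classical
  have bound : ∀ I : Set (Fin k), ∃ N : ℕ, ∀ n : ℕ,
      (∀ i ∈ I, N < padicValNat (p i) (s n)) →
      ∃ φ : ℕ → ℕ, StrictMono φ ∧
        ∀ i ∈ I, StrictMono (fun m => padicValNat (p i) (s (φ m))) := by
    intro I
    by_cases h : ∀ N, ∃ n, ∀ i ∈ I, N < padicValNat (p i) (s n)
    · exact ⟨0, fun _ _ =>
        exists_common_strictMono_subsequence (fun i n => padicValNat (p i) (s n)) I h⟩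
    · obtain ⟨N, hN⟩ := not_forall.1 h
      exact ⟨N, fun n hn => absurd ⟨n, hn⟩ hN⟩
  choose N hN using bound
  exact ⟨Finset.univ.sup N, fun n I hI => hN I n fun i hi =>
    (Finset.le_sup (Finset.mem_univ I)).trans_lt (hI i hi)⟩
end

section
/- Let M be a nontrivial strongly bounded Puiseux monoid that is finite, i.e., there exists a finite set of primes P with v_p(m) ≥ 0 for every nonzero m ∈ M and every prime p ∉ P. Then M is atomic if and only if M is isomorphic as an additive monoid to a numerical semigroup. Moreover, every strongly bounded finite Puiseux monoid has only finitely many atoms. -/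
/-- `M` is a finite Puiseux monoid: a Puiseux monoid over some finite set of primes. -/
def FinitePM (M : AddSubmonoid ℚ) : Prop :=
  ∃ P : Finset ℕ, (∀ p ∈ P, Nat.Prime p) ∧
    ∀ x ∈ M, x ≠ 0 → ∀ p : ℕ, p.Prime → p ∉ P → 0 ≤ padicValRat p x

/-- Two atoms with the same numerator are equal if the denominators divide. -/
theorem PMAtom.eq_of_num_eq_of_den_dvd {M : AddSubmonoid ℚ} {a b : ℚ} (ha : PMAtom M a)
    (hb : PMAtom M b) (hnum : a.num = b.num) (hden : a.den ∣ b.den) : a = b := by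
  obtain ⟨k, hk⟩ := hden
  have hab : a = k * b := by
    have ha0 : (a.den : ℚ) ≠ 0 := by exact_mod_cast a.den_ne_zero
    have hk0 : (k : ℚ) ≠ 0 := by
      rintro h
      have : k = 0 := by exact_mod_cast h
      exact b.den_ne_zero (by simp [hk, this])
    rw [← Rat.num_div_den a, ← Rat.num_div_den b, hk, hnum]
    push_cast
    field_simp
  rcases k with _ | j
  · exact absurd hk (by simp)
  · have hsum : a = b + j • b := by
      rw [hab, nsmul_eq_mul]
      push_cast
      ring
    rcases ha.2.2 b hb.1 (j • b) (M.nsmul_mem hb.1 j) hsum with h | h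
    · exact absurd h hb.2.1
    · rw [hsum, h, add_zero]

theorem PMAtom.mem_of_closure_eq {M : AddSubmonoid ℚ} {S : Set ℚ}
    (hS : AddSubmonoid.closure S = M) {a : ℚ} (ha : PMAtom M a) : a ∈ S := by
  subst hS
  have hmem := ha.1
  induction hmem using AddSubmonoid.closure_induction with
  | mem x hx => exact hx
  | zero => exact absurd rfl ha.2.1
  | add x y hx hy ihx ihy =>
    rcases ha.2.2 x hx y hy rfl with rfl | rfl
    · simpa using ihy (by simpa using ha)
    · simpa using ihx (by simpa using ha)

theorem padicValRat_neg_of_dvd_den {p : ℕ} (hp : p.Prime) {q : ℚ} (h : p ∣ q.den) :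
    padicValRat p q < 0 := by
  have : Fact p.Prime := ⟨hp⟩
  have hnum : ¬ p ∣ q.num.natAbs := fun h' ↦
    hp.one_lt.ne' (Nat.eq_one_of_dvd_coprimes q.reduced h' h)
  have hden := one_le_padicValNat_of_dvd q.den_ne_zero h
  rw [padicValRat, padicValInt, padicValNat.eq_zero_of_not_dvd hnum]
  omega

theorem PMAtoms_finite {M : AddSubmonoid ℚ} (hM : IsPuiseux M) (hsb : StronglyBounded M)
    (hfin : FinitePM M) : (PMAtoms M).Finite := by
  obtain ⟨S, hS, B, hB⟩ := hsb
  obtain ⟨P, -, hP⟩ := hfin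
  refine Set.Finite.of_finite_fibers Rat.num ((Set.finite_Icc 0 B).subset ?_) fun n _ ↦ ?_
  · rintro _ ⟨a, ha, rfl⟩
    exact ⟨Rat.num_nonneg.2 (hM a ha.1), hB a (PMAtom.mem_of_closure_eq hS ha)⟩
  · let f : ℚ → P → ℕ := fun q p ↦ q.den.factorization p
    have key : ∀ a ∈ PMAtoms M ∩ Rat.num ⁻¹' {n}, ∀ b ∈ PMAtoms M ∩ Rat.num ⁻¹' {n},
        f a ≤ f b → a = b := by
      rintro a ⟨ha, han⟩ b ⟨hb, hbn⟩ hab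
      refine ha.eq_of_num_eq_of_den_dvd hb (han.trans hbn.symm) ?_
      rw [← Nat.factorization_le_iff_dvd a.den_ne_zero b.den_ne_zero]
      intro p
      by_cases hpP : p ∈ P
      · exact hab ⟨p, hpP⟩
      by_cases hp : p.Prime
      · have hndvd : ¬ p ∣ a.den := fun h ↦
          (padicValRat_neg_of_dvd_den hp h).not_ge (hP a ha.1 ha.2.1 p hp hpP)
        simp [Nat.factorization_eq_zero_of_not_dvd hndvd]
      · simp [Nat.factorization_eq_zero_of_not_prime _ hp]
    refine Set.Finite.of_finite_image (f := f) ?_ fun a ha b hb hab ↦ key a ha b hb hab.le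
    refine WellQuasiOrderedLE.finite_of_isAntichain ?_
    rintro _ ⟨a, ha, rfl⟩ _ ⟨b, hb, rfl⟩ hne hab
    exact hne (congrArg f (key a ha b hb hab))

theorem PMAtomic.of_addEquiv {M : AddSubmonoid ℚ} {N : AddSubmonoid ℕ} (e : M ≃+ N) :
    PMAtomic M := by
  suffices H : ∀ n : ℕ, ∀ m : M, (e m : ℕ) = n →
      ∃ l : Multiset ℚ, (∀ a ∈ l, PMAtom M a) ∧ l.sum = m from
    fun m hm ↦ H _ ⟨m, hm⟩ rfl
  intro n
  induction n using Nat.strong_induction_on with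
  | _ n ih =>
    rintro m rfl
    by_cases hm0 : (m : ℚ) = 0
    · exact ⟨0, by simp, by simp [hm0]⟩
    by_cases hma : PMAtom M m
    · exact ⟨{(m : ℚ)}, by simpa using hma, by simp⟩
    have hdec : ∃ x ∈ M, ∃ y ∈ M, (m : ℚ) = x + y ∧ x ≠ 0 ∧ y ≠ 0 := by
      by_contra! h
      refine hma ⟨m.2, hm0, fun x hx y hy hxy ↦ ?_⟩
      by_cases hx0 : x = 0
      · exact .inl hx0
      · exact .inr (h x hx y hy hxy hx0)
    obtain ⟨x, hx, y, hy, hxy, hx0, hy0⟩ := hdec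
    have hpos : ∀ z : M, (z : ℚ) ≠ 0 → 0 < (e z : ℕ) := fun z hz ↦ by
      refine Nat.pos_of_ne_zero fun h ↦ hz ?_
      have : e z = 0 := Subtype.ext h
      rw [(map_eq_zero_iff e e.injective).1 this]
      rfl
    have hadd : (e m : ℕ) = e ⟨x, hx⟩ + e ⟨y, hy⟩ := by
      have : m = ⟨x, hx⟩ + ⟨y, hy⟩ := Subtype.ext hxy
      rw [this, map_add]
      rfl
    have hxpos := hpos ⟨x, hx⟩ hx0
    have hypos := hpos ⟨y, hy⟩ hy0
    obtain ⟨l₁, hl₁, hs₁⟩ := ih _ (by omega) ⟨x, hx⟩ rfl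
    obtain ⟨l₂, hl₂, hs₂⟩ := ih _ (by omega) ⟨y, hy⟩ rfl
    refine ⟨l₁ + l₂, fun a ha ↦ ?_, by rw [Multiset.sum_add, hs₁, hs₂, hxy]⟩
    exact (Multiset.mem_add.1 ha).elim (hl₁ a) (hl₂ a)

/-- A nontrivial submonoid of `ℚ` contained in `c ℕ` with `c ≠ 0` is isomorphic to a numerical
semigroup. -/
theorem exists_addEquiv_numerical_of_forall_eq_mul {M : AddSubmonoid ℚ} (hnt : M ≠ ⊥) {c : ℚ}
    (hc : c ≠ 0) (hM : ∀ m ∈ M, ∃ n : ℕ, m = n * c) :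
    ∃ N : AddSubmonoid ℕ, (Set.univ \ (N : Set ℕ)).Finite ∧ Nonempty (M ≃+ N) := by
  let s : Set ℕ := {n | (n : ℚ) * c ∈ M}
  let g := Nat.setGcd s
  have hg : g ≠ 0 := by
    intro h
    refine hnt ((AddSubmonoid.eq_bot_iff_forall _).2 fun m hm ↦ ?_)
    obtain ⟨n, rfl⟩ := hM m hm
    have : n = 0 := Nat.setGcd_eq_zero_iff.1 h hm
    simp [this]
  have hgc : (g : ℚ) * c ≠ 0 := mul_ne_zero (by exact_mod_cast hg) hc
  let f : ℕ →+ ℚ := (AddMonoidHom.mulRight ((g : ℚ) * c)).comp (Nat.castAddMonoidHom ℚ)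
  have hf : ∀ k, f k = k * (g * c) := fun _ ↦ rfl
  have hfinj : Function.Injective f := fun a b hab ↦ by
    rw [hf, hf] at hab
    exact_mod_cast mul_right_cancel₀ hgc hab
  have hmul : ∀ n ∈ s, ∃ k ∈ M.comap f, n = g * k := fun n hn ↦ by
    obtain ⟨k, hk⟩ := Nat.setGcd_dvd_of_mem hn
    refine ⟨k, ?_, hk⟩
    have hn' : (n : ℚ) * c ∈ M := hn
    rw [AddSubmonoid.mem_comap, hf]
    convert hn' using 1
    rw [hk]
    push_cast
    ring
  refine ⟨M.comap f, ?_, ⟨(AddEquiv.ofBijective (f.addSubmonoidComap M) ⟨?_, ?_⟩).symm⟩⟩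
  · have hone : Nat.setGcd (M.comap f : Set ℕ) = 1 := by
      have hdvd : g * Nat.setGcd (M.comap f : Set ℕ) ∣ g := by
        refine Nat.dvd_setGcd_iff.2 fun n hn ↦ ?_
        obtain ⟨k, hk, rfl⟩ := hmul n hn
        exact mul_dvd_mul_left g (Nat.setGcd_dvd_of_mem hk)
      exact Nat.dvd_one.1 <|
        Nat.dvd_of_mul_dvd_mul_left (Nat.pos_of_ne_zero hg) (by simpa using hdvd)
    obtain ⟨n, hn⟩ := Nat.exists_mem_closure_of_ge (M.comap f : Set ℕ)
    refine (Set.finite_Iio n).subset fun m hm ↦ Set.mem_Iio.2 (lt_of_not_ge fun hnm ↦ hm.2 ?_)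
    exact AddSubmonoid.closure_le.2 subset_rfl (hn m hnm (hone ▸ one_dvd m))
  · exact fun a b hab ↦ Subtype.ext (hfinj (congrArg Subtype.val hab))
  · rintro ⟨m, hm⟩
    obtain ⟨n, rfl⟩ := hM m hm
    obtain ⟨k, hk, rfl⟩ := hmul n hm
    refine ⟨⟨k, hk⟩, Subtype.ext ?_⟩
    change f k = _
    rw [hf]
    push_cast
    ring

theorem PMAtomic.exists_forall_eq_mul {M : AddSubmonoid ℚ} (hM : IsPuiseux M)
    (hat : PMAtomic M) (hfin : (PMAtoms M).Finite) :
    ∃ c : ℚ, c ≠ 0 ∧ ∀ m ∈ M, ∃ n : ℕ, m = n * c := by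
  let D : ℕ := ∏ a ∈ hfin.toFinset, a.den
  have hD : (D : ℚ) ≠ 0 := by
    exact Nat.cast_ne_zero.2 (Finset.prod_ne_zero_iff.2 fun a _ ↦ Rat.den_ne_zero a)
  have hatom : ∀ a, PMAtom M a → ∃ n : ℕ, a = n * (D : ℚ)⁻¹ := fun a ha ↦ by
    obtain ⟨k, hk⟩ : a.den ∣ D := Finset.dvd_prod_of_mem _ (hfin.mem_toFinset.2 ha)
    refine ⟨a.num.toNat * k, ?_⟩
    have hnum : ((a.num.toNat : ℕ) : ℚ) = a.num := by
      exact_mod_cast Int.toNat_of_nonneg (Rat.num_nonneg.2 (hM a ha.1))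
    rw [eq_mul_inv_iff_mul_eq₀ hD, hk]
    push_cast
    rw [hnum, ← mul_assoc, Rat.mul_den_eq_num]
  refine ⟨(D : ℚ)⁻¹, inv_ne_zero hD, fun m hm ↦ ?_⟩
  obtain ⟨l, hl, rfl⟩ := hat m hm
  clear hm
  induction l using Multiset.induction_on with
  | empty => exact ⟨0, by simp⟩
  | cons a l ih =>
    obtain ⟨n₁, h₁⟩ := hatom a (hl a (Multiset.mem_cons_self a l))
    obtain ⟨n₂, h₂⟩ := ih fun b hb ↦ hl b (Multiset.mem_cons_of_mem hb)
    refine ⟨n₁ + n₂, ?_⟩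
    rw [Multiset.sum_cons, h₂]
    conv_lhs => rw [h₁]
    push_cast
    ring

/-- A nontrivial strongly bounded finite Puiseux monoid is atomic if and only
if it is isomorphic to a numerical semigroup. Moreover, every strongly bounded finite
Puiseux monoid has only finitely many atoms. -/
theorem strongly_bounded_finite_atomic_iff_numerical (M : AddSubmonoid ℚ)
    (hM : IsPuiseux M) (hnt : M ≠ ⊥) (hsb : StronglyBounded M) (hfin : FinitePM M) :
    (PMAtomic M ↔
      ∃ N : AddSubmonoid ℕ, (Set.univ \ (N : Set ℕ)).Finite ∧ Nonempty (M ≃+ N)) ∧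
    (∀ M' : AddSubmonoid ℚ, IsPuiseux M' → StronglyBounded M' → FinitePM M' →
      (PMAtoms M').Finite) := by
  refine ⟨⟨fun hat ↦ ?_, ?_⟩, fun M' hM' hsb' hfin' ↦ PMAtoms_finite hM' hsb' hfin'⟩
  · obtain ⟨c, hc, hmul⟩ := hat.exists_forall_eq_mul hM (PMAtoms_finite hM hsb hfin)
    exact exists_addEquiv_numerical_of_forall_eq_mul hnt hc hmul
  · rintro ⟨N, -, ⟨e⟩⟩
    exact PMAtomic.of_addEquiv e
end

section
/- Let M be the Puiseux monoid generated by {1/p : p prime}. Then 𝒜(M) = {1/p : p prime}; in particular, M is atomic, has infinitely many atoms, and is not finitely generated (hence not isomorphic to a numerical semigroup). -/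
theorem nonneg_of_mem_closure_reciprocals {x : ℚ}
    (hx : x ∈ AddSubmonoid.closure {x : ℚ | ∃ p : ℕ, p.Prime ∧ x = 1 / (p : ℚ)}) : 0 ≤ x := by
  induction hx using AddSubmonoid.closure_induction with
  | mem x hx =>
    obtain ⟨p, -, rfl⟩ := hx
    positivity
  | zero => exact le_rfl
  | add x y _ _ hx hy => exact add_nonneg hx hy

theorem not_dvd_add_den {p : ℕ} (hp : p.Prime) {x y : ℚ} (hx : ¬ p ∣ x.den) (hy : ¬ p ∣ y.den) :
    ¬ p ∣ (x + y).den := fun h =>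
  (hp.dvd_mul.mp (h.trans (Rat.add_den_dvd x y))).elim hx hy

theorem den_one_div_prime {p : ℕ} (hp : p.Prime) : (1 / (p : ℚ)).den = p := by
  rw [one_div, Rat.inv_natCast_den_of_pos hp.pos]

/-- An element of the monoid generated by the reciprocals of the primes whose denominator is
divisible by `p` is at least `1 / p`. -/
theorem not_dvd_den_or_one_div_le {p : ℕ} (hp : p.Prime) {x : ℚ}
    (hx : x ∈ AddSubmonoid.closure {x : ℚ | ∃ p : ℕ, p.Prime ∧ x = 1 / (p : ℚ)}) :
    ¬ p ∣ x.den ∨ 1 / (p : ℚ) ≤ x := by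
  induction hx using AddSubmonoid.closure_induction with
  | mem x hx =>
    obtain ⟨q, hq, rfl⟩ := hx
    by_cases hpq : p = q
    · exact Or.inr (by rw [hpq])
    · left
      rwa [den_one_div_prime hq, Nat.prime_dvd_prime_iff_eq hp hq]
  | zero => exact Or.inl (by simpa using hp.one_lt.ne')
  | add x y hx hy ihx ihy =>
    have hx0 := nonneg_of_mem_closure_reciprocals hx
    have hy0 := nonneg_of_mem_closure_reciprocals hy
    rcases ihx with ihx | ihx
    · rcases ihy with ihy | ihy
      · exact Or.inl (not_dvd_add_den hp ihx ihy)
      · exact Or.inr (by linarith)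
    · exact Or.inr (by linarith)

theorem PMAtom_one_div_prime {p : ℕ} (hp : p.Prime) :
    PMAtom (AddSubmonoid.closure {x : ℚ | ∃ p : ℕ, p.Prime ∧ x = 1 / (p : ℚ)}) (1 / (p : ℚ)) := by
  refine ⟨AddSubmonoid.subset_closure ⟨p, hp, rfl⟩,
    one_div_ne_zero (Nat.cast_ne_zero.mpr hp.ne_zero), fun x hx y hy h => ?_⟩
  have hx0 := nonneg_of_mem_closure_reciprocals hx
  have hy0 := nonneg_of_mem_closure_reciprocals hy
  rcases not_dvd_den_or_one_div_le hp hx with hx' | hx'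
  · rcases not_dvd_den_or_one_div_le hp hy with hy' | hy'
    · refine absurd ?_ (not_dvd_add_den hp hx' hy')
      rw [← h, den_one_div_prime hp]
    · exact Or.inl (by linarith)
  · exact Or.inr (by linarith)

theorem infinite_reciprocals_of_primes :
    {x : ℚ | ∃ p : ℕ, p.Prime ∧ x = 1 / (p : ℚ)}.Infinite := by
  refine (Nat.infinite_setOfPred_prime.image (f := fun p : ℕ => 1 / (p : ℚ)) ?_).mono ?_
  · intro p _ q _ h
    simpa using h
  · rintro _ ⟨p, hp, rfl⟩
    exact ⟨p, hp, rfl⟩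

/-- The monoid generated by the reciprocals of the primes does not embed in `ℕ`. -/
theorem not_injective_closure_reciprocals_to_nat
    (f : AddSubmonoid.closure {x : ℚ | ∃ p : ℕ, p.Prime ∧ x = 1 / (p : ℚ)} →+ ℕ) :
    ¬ Function.Injective f := by
  intro hf
  let r (p : ℕ) (hp : p.Prime) :
      AddSubmonoid.closure {x : ℚ | ∃ p : ℕ, p.Prime ∧ x = 1 / (p : ℚ)} :=
    ⟨1 / (p : ℚ), AddSubmonoid.subset_closure ⟨p, hp, rfl⟩⟩
  obtain ⟨p, hle, hp⟩ := Nat.exists_infinite_primes (f (2 • r 2 Nat.prime_two) + 1)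
  have hr : 2 • r 2 Nat.prime_two = p • r p hp := by
    ext
    have hp0 : (p : ℚ) ≠ 0 := Nat.cast_ne_zero.mpr hp.ne_zero
    simp [r, hp0]
  have hpos : f (r p hp) ≠ 0 := by
    rw [map_ne_zero_iff f hf]
    intro h
    exact (PMAtom_one_div_prime hp).2.1 (congrArg Subtype.val h)
  have hmul : f (2 • r 2 Nat.prime_two) = p * f (r p hp) := by
    rw [hr, map_nsmul, smul_eq_mul]
  have := Nat.le_mul_of_pos_right p (Nat.pos_of_ne_zero hpos)
  omega

/-- For the Puiseux monoid `M = ⟨1/p : p prime⟩` one has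
`𝒜(M) = {1/p : p prime}`; in particular `M` is atomic, has infinitely many atoms, and is
not finitely generated (hence not isomorphic to a numerical semigroup). -/
theorem reciprocals_of_primes_atomic (M : AddSubmonoid ℚ)
    (hM : M = AddSubmonoid.closure {x : ℚ | ∃ p : ℕ, p.Prime ∧ x = 1 / (p : ℚ)}) :
    PMAtoms M = {x : ℚ | ∃ p : ℕ, p.Prime ∧ x = 1 / (p : ℚ)} ∧
    PMAtomic M ∧ (PMAtoms M).Infinite ∧
    ¬ (∃ S : Set ℚ, S.Finite ∧ AddSubmonoid.closure S = M) ∧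
    ¬ (∃ N : AddSubmonoid ℕ, (Set.univ \ (N : Set ℕ)).Finite ∧ Nonempty (M ≃+ N)) := by
  subst hM
  have hatoms : PMAtoms (AddSubmonoid.closure {x : ℚ | ∃ p : ℕ, p.Prime ∧ x = 1 / (p : ℚ)}) =
      {x : ℚ | ∃ p : ℕ, p.Prime ∧ x = 1 / (p : ℚ)} := by
    refine Set.Subset.antisymm (fun a ha => PMAtom.mem_of_closure ha) ?_
    rintro _ ⟨p, hp, rfl⟩
    exact PMAtom_one_div_prime hp
  refine ⟨hatoms, fun m hm => ?_, by rw [hatoms]; exact infinite_reciprocals_of_primes, ?_, ?_⟩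
  · obtain ⟨l, hl, hsum⟩ := AddSubmonoid.exists_multiset_of_mem_closure hm
    refine ⟨l, fun a ha => ?_, hsum⟩
    obtain ⟨p, hp, rfl⟩ := hl a ha
    exact PMAtom_one_div_prime hp
  · rintro ⟨S, hS, hSM⟩
    refine infinite_reciprocals_of_primes (hS.subset ?_)
    rw [← hatoms, ← hSM]
    exact fun a ha => PMAtom.mem_of_closure ha
  · rintro ⟨N, -, ⟨e⟩⟩
    exact not_injective_closure_reciprocals_to_nat (N.subtype.comp e.toAddMonoidHom)
      (Subtype.val_injective.comp e.injective)
end
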